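/- arXiv:1006.2249 — 5 statements merged into one kernel-verified Lean document; each statement's English description precedes it below -/
import Mathlib

section
/- The integrality gap of the hypergraphic LP (S) is at most 1 + (ln 3)/2: for every instance (G, c, R) of the Steiner tree problem, the minimum cost opt of a Steiner tree satisfies opt ≤ (1 + (ln 3)/2) · lp*, where lp* is the optimal value of (S). -/
/-!
Setting: a finite graph on vertex type `V` is given by its edge set `E : Finset (Sym2 V)`,
with edge costs `c : Sym2 V → ℝ` (nonnegative, satisfying the triangle inequality).
The terminals form a set `R : Finset V`; all other vertices are Steiner vertices.
-/

open Finset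

variable {V : Type} [Fintype V] [DecidableEq V]

/-- The total cost of a finite set of edges. -/
def cost (c : Sym2 V → ℝ) (F : Finset (Sym2 V)) : ℝ := ∑ e ∈ F, c e

/-- The degree of the vertex `v` in the edge set `F`. -/
def degIn (F : Finset (Sym2 V)) (v : V) : ℕ := (F.filter fun e => v ∈ e).card

/-- All pairs of vertices of `K`, as potential edges (the clique on `K`). -/
def cliqueEdges (K : Finset V) : Finset (Sym2 V) := (K ×ˢ K).image fun p => s(p.1, p.2)

/-- `F ⊆ E` is (the edge set of) a Steiner tree for the terminal set `R` in the graph with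
edge set `E`: an acyclic edge set in which all terminals are mutually connected and every
vertex touched by `F` is connected to a terminal, i.e. a tree spanning `R` plus any subset
of the Steiner vertices. -/
def IsSteinerTree (E : Finset (Sym2 V)) (R : Finset V) (F : Finset (Sym2 V)) : Prop :=
  F ⊆ E ∧
  (SimpleGraph.fromEdgeSet (↑F : Set (Sym2 V))).IsAcyclic ∧
  (∀ u ∈ R, ∀ v ∈ R, (SimpleGraph.fromEdgeSet (↑F : Set (Sym2 V))).Reachable u v) ∧
  (∀ v : V, degIn F v ≠ 0 → ∃ r ∈ R, (SimpleGraph.fromEdgeSet (↑F : Set (Sym2 V))).Reachable v r)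

/-- `F ⊆ E` is a full component on the terminal set `K ⊆ R` (`|K| ≥ 2`): a tree whose leaf
set is exactly `K` and whose internal vertices are Steiner vertices. -/
def IsFullComponent (E : Finset (Sym2 V)) (R K : Finset V) (F : Finset (Sym2 V)) : Prop :=
  F ⊆ E ∧ K ⊆ R ∧ 2 ≤ K.card ∧
  (SimpleGraph.fromEdgeSet (↑F : Set (Sym2 V))).IsAcyclic ∧
  (∀ u v : V, degIn F u ≠ 0 → degIn F v ≠ 0 →
    (SimpleGraph.fromEdgeSet (↑F : Set (Sym2 V))).Reachable u v) ∧
  (∀ v : V, degIn F v = 1 ↔ v ∈ K) ∧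
  (∀ v : V, 2 ≤ degIn F v → v ∉ R)

/-- `T` is a spanning tree of the induced terminal graph `G[R]`. -/
def IsSpanningTreeOn (E : Finset (Sym2 V)) (R : Finset V) (T : Finset (Sym2 V)) : Prop :=
  T ⊆ E ∧ (∀ e ∈ T, ∀ v ∈ e, v ∈ R) ∧
  (SimpleGraph.fromEdgeSet (↑T : Set (Sym2 V))).IsAcyclic ∧
  (∀ u ∈ R, ∀ v ∈ R, (SimpleGraph.fromEdgeSet (↑T : Set (Sym2 V))).Reachable u v)

/-- `m` is the minimum of `cost c` over edge sets satisfying `P`. -/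
def IsMinCostOf (P : Finset (Sym2 V) → Prop) (c : Sym2 V → ℝ) (m : ℝ) : Prop :=
  (∃ F, P F ∧ cost c F = m) ∧ ∀ F, P F → m ≤ cost c F

/-- Feasibility for the hypergraphic LP (S): `x` is nonnegative, supported on terminal sets
`K ⊆ R` with `|K| ≥ 2` admitting a full component, and satisfies
`∑_{K : K∩S ≠ ∅} x_K (|K∩S|-1) ≤ |S|-1` for every nonempty `S ⊆ R` as well as
`∑_K x_K (|K|-1) = |R|-1`. -/
def LPFeasible (E : Finset (Sym2 V)) (R : Finset V) (x : Finset V → ℝ) : Prop :=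
  (∀ K, 0 ≤ x K) ∧
  (∀ K : Finset V, x K ≠ 0 → K ⊆ R ∧ 2 ≤ K.card ∧ ∃ F, IsFullComponent E R K F) ∧
  (∀ S ⊆ R, S.Nonempty →
    ∑ K ∈ Finset.univ.filter (fun K : Finset V => (K ∩ S).Nonempty),
      x K * (((K ∩ S).card : ℝ) - 1) ≤ (S.card : ℝ) - 1) ∧
  (∑ K : Finset V, x K * ((K.card : ℝ) - 1) = (R.card : ℝ) - 1)

/-- The objective value `∑_K C_K x_K` of the hypergraphic LP. -/
def lpValue (CK x : Finset V → ℝ) : ℝ := ∑ K : Finset V, CK K * x K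

/-- `v` is the optimal value of the hypergraphic LP (S), with `CK K` the cost of a
minimum-cost full component on `K`. -/
def IsLPOpt (E : Finset (Sym2 V)) (R : Finset V) (CK : Finset V → ℝ) (v : ℝ) : Prop :=
  (∃ x, LPFeasible E R x ∧ lpValue CK x = v) ∧ ∀ x, LPFeasible E R x → v ≤ lpValue CK x

section Linked

variable {α β : Type*}

/-- Connectivity of vertices by a finite family of links, each of which joins its two ends. -/
def Linked (ends : α → Sym2 V) (T : Finset α) : V → V → Prop :=
  Relation.ReflTransGen fun a b => ∃ e ∈ T, ends e = s(a, b)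

namespace Linked

omit [Fintype V] [DecidableEq V]

variable {ends : α → Sym2 V} {T T' : Finset α} {u v w p q r : V} {e : α}

theorem refl (v : V) : Linked ends T v v := Relation.ReflTransGen.refl

theorem trans (h : Linked ends T u v) (h' : Linked ends T v w) : Linked ends T u w :=
  Relation.ReflTransGen.trans h h'

theorem symm (h : Linked ends T u v) : Linked ends T v u :=
  have : Std.Symm fun a b => ∃ e ∈ T, ends e = s(a, b) :=
    ⟨fun _ _ ⟨e, he, hab⟩ => ⟨e, he, hab.trans Sym2.eq_swap⟩⟩
  Relation.ReflTransGen.stdSymm.symm _ _ h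

theorem of_mem (he : e ∈ T) (h : ends e = s(u, v)) : Linked ends T u v :=
  Relation.ReflTransGen.single ⟨e, he, h⟩

theorem lift {ends' : β → Sym2 V} {U : Finset β}
    (hstep : ∀ e ∈ T, ∀ a b, ends e = s(a, b) → Linked ends' U a b)
    (h : Linked ends T u v) : Linked ends' U u v := by
  induction h with
  | refl => exact refl _
  | tail _ hbc ih =>
    obtain ⟨e, he, hab⟩ := hbc
    exact ih.trans (hstep e he _ _ hab)

theorem mono (hTT' : T ⊆ T') (h : Linked ends T u v) : Linked ends T' u v :=
  h.lift fun _ he _ _ hab => of_mem (hTT' he) hab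

theorem reachable_iff {F : Finset (Sym2 V)} :
    (SimpleGraph.fromEdgeSet (↑F : Set (Sym2 V))).Reachable u v ↔ Linked id F u v := by
  rw [SimpleGraph.reachable_iff_reflTransGen]
  constructor
  · intro h
    induction h with
    | refl => exact refl _
    | tail _ hbc ih =>
      rw [SimpleGraph.fromEdgeSet_adj] at hbc
      exact ih.trans (of_mem (by simpa using hbc.1) rfl)
  · intro h
    induction h with
    | refl => exact Relation.ReflTransGen.refl
    | @tail b d _ hbc ih =>
      obtain ⟨e, he, hab⟩ := hbc
      by_cases hbd : b = d
      · exact hbd ▸ ih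
      · refine ih.tail ?_
        rw [SimpleGraph.fromEdgeSet_adj]
        exact ⟨by simpa using hab ▸ he, hbd⟩

variable [DecidableEq α]

theorem erase_of_linked (he : ends e = s(p, q)) (hpq : Linked ends (T.erase e) p q)
    (h : Linked ends T u v) : Linked ends (T.erase e) u v := by
  refine h.lift fun e' he' a b hab => ?_
  by_cases hee : e' = e
  · subst hee
    rw [he, Sym2.eq_iff] at hab
    obtain ⟨rfl, rfl⟩ | ⟨rfl, rfl⟩ := hab
    · exact hpq
    · exact hpq.symm
  · exact of_mem (mem_erase.2 ⟨hee, he'⟩) hab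

theorem erase_or_erase (he : ends e = s(p, q)) (h : Linked ends T p v) :
    Linked ends (T.erase e) p v ∨ Linked ends (T.erase e) q v := by
  induction h with
  | refl => exact Or.inl (refl _)
  | tail _ hbc ih =>
    obtain ⟨e', he', hab⟩ := hbc
    by_cases hee : e' = e
    · subst hee
      rw [he, Sym2.eq_iff] at hab
      obtain ⟨rfl, rfl⟩ | ⟨rfl, rfl⟩ := hab
      · exact Or.inr (refl _)
      · exact Or.inl (refl _)
    · have := of_mem (mem_erase.2 ⟨hee, he'⟩) hab
      exact ih.imp (fun h => h.trans this) fun h => h.trans this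

theorem erase_or_linked (he : ends e = s(p, q)) (hmem : e ∈ T) (h : Linked ends T u v) :
    Linked ends (T.erase e) u v ∨ Linked ends T u p := by
  induction h with
  | refl => exact Or.inl (refl _)
  | @tail b d hub hbc ih =>
    obtain ⟨e', he', hab⟩ := hbc
    by_cases hee : e' = e
    · subst hee
      rw [he, Sym2.eq_iff] at hab
      obtain ⟨rfl, rfl⟩ | ⟨rfl, rfl⟩ := hab
      · exact Or.inr hub
      · exact Or.inr (trans hub (of_mem he' (he.trans Sym2.eq_swap)))
    · exact ih.imp_left fun h => h.trans (of_mem (mem_erase.2 ⟨hee, he'⟩) hab)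

end Linked

/-- The links of `T` that lie in the connected component of `r`. -/
noncomputable def linkComponent (ends : α → Sym2 V) (T : Finset α) (r : V) : Finset α :=
  @Finset.filter _ (fun e => ∀ v ∈ ends e, Linked ends T r v) (Classical.decPred _) T

section

omit [Fintype V] [DecidableEq V]

variable {ends : α → Sym2 V} {T : Finset α} {p q r v : V}

theorem mem_linkComponent {e : α} :
    e ∈ linkComponent ends T r ↔ e ∈ T ∧ ∀ v ∈ ends e, Linked ends T r v := by
  simp [linkComponent]

theorem linkComponent_subset : linkComponent ends T r ⊆ T := by
  intro e he
  exact (mem_linkComponent.1 he).1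

theorem Linked.linkComponent (h : Linked ends T r v) :
    Linked ends (linkComponent ends T r) r v := by
  induction h with
  | refl => exact Linked.refl _
  | @tail b d hrb hbd ih =>
    obtain ⟨e, he, hab⟩ := hbd
    refine ih.trans (Linked.of_mem (mem_linkComponent.2 ⟨he, fun x hx => ?_⟩) hab)
    rw [hab, Sym2.mem_iff] at hx
    obtain rfl | rfl := hx
    · exact hrb
    · exact Linked.trans hrb (Linked.of_mem he hab)

theorem disjoint_linkComponent (h : ¬ Linked ends T p q) :
    Disjoint (linkComponent ends T p) (linkComponent ends T q) := by
  rw [Finset.disjoint_left]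
  intro e he he'
  obtain ⟨a, b, hab⟩ : ∃ a b, ends e = s(a, b) := by
    induction h : ends e with | _ a b => exact ⟨a, b, rfl⟩
  have ha : a ∈ ends e := by simp [hab]
  exact h (((mem_linkComponent.1 he).2 a ha).trans ((mem_linkComponent.1 he').2 a ha).symm)

theorem sum_linkComponent_le [DecidableEq α] {e : α} (he : e ∈ T) (f : α → ℝ)
    (hf : ∀ e ∈ T, 0 ≤ f e)
    (h : ¬ Linked ends (T.erase e) p q) :
    ∑ i ∈ linkComponent ends (T.erase e) p, f i + ∑ i ∈ linkComponent ends (T.erase e) q, f i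
      + f e ≤ ∑ i ∈ T, f i := by
  rw [← sum_union (disjoint_linkComponent h), ← sum_erase_add T f he]
  have hsub : linkComponent ends (T.erase e) p ∪ linkComponent ends (T.erase e) q ⊆ T.erase e :=
    union_subset linkComponent_subset linkComponent_subset
  have := sum_le_sum_of_subset_of_nonneg (f := f) hsub fun i hi _ => hf i (mem_of_mem_erase hi)
  linarith

end

end Linked

section Cost

variable {E F F' Y : Finset (Sym2 V)} {R : Finset V} {c : Sym2 V → ℝ}

omit [Fintype V] [DecidableEq V] in
theorem cost_nonneg (hc : ∀ e, 0 ≤ c e) (F : Finset (Sym2 V)) : 0 ≤ cost c F :=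
  sum_nonneg fun e _ => hc e

omit [Fintype V] [DecidableEq V] in
theorem cost_mono (hc : ∀ e, 0 ≤ c e) (h : F ⊆ F') : cost c F ≤ cost c F' :=
  sum_le_sum_of_subset_of_nonneg h fun e _ _ => hc e

omit [Fintype V] in
theorem cost_union_le (hc : ∀ e, 0 ≤ c e) (F F' : Finset (Sym2 V)) :
    cost c (F ∪ F') ≤ cost c F + cost c F' := by
  have := sum_union_inter (s₁ := F) (s₂ := F') (f := c)
  have h := cost_nonneg hc (F ∩ F')
  unfold cost at *
  linarith

/-- A connected subgraph containing all terminals contains a Steiner tree. -/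
theorem exists_isSteinerTree_subset (hYE : Y ⊆ E)
    (hY : ∀ u ∈ R, ∀ v ∈ R, Linked id Y u v) : ∃ F ⊆ Y, IsSteinerTree E R F := by
  classical
  obtain ⟨F, hF, hmin⟩ := exists_min_image
    (Y.powerset.filter fun F => ∀ u ∈ R, ∀ v ∈ R, Linked id F u v) card
    ⟨Y, by simpa using hY⟩
  simp only [mem_filter, mem_powerset] at hF hmin
  have hcrit : ∀ e ∈ F, ¬ ∀ u ∈ R, ∀ v ∈ R, Linked id (F.erase e) u v := by
    intro e he h
    have := hmin (F.erase e) ⟨(erase_subset _ _).trans hF.1, h⟩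
    have := card_erase_lt_of_mem he
    omega
  refine ⟨F, hF.1, hF.1.trans hYE, ?_, ?_, ?_⟩
  · rw [SimpleGraph.isAcyclic_iff_forall_adj_isBridge]
    intro p q hpq
    rw [SimpleGraph.isBridge_iff]
    intro hreach
    rw [SimpleGraph.fromEdgeSet_adj] at hpq
    have hpqF : s(p, q) ∈ F := by simpa using hpq.1
    refine hcrit _ hpqF fun u hu v hv => ?_
    refine Linked.erase_of_linked (p := p) (q := q) rfl ?_ (hF.2 u hu v hv)
    rw [← Linked.reachable_iff]
    convert hreach using 1
    ext a b
    simp [SimpleGraph.fromEdgeSet_adj]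
  · intro u hu v hv
    exact Linked.reachable_iff.2 (hF.2 u hu v hv)
  · intro v hv
    obtain ⟨e, he⟩ := card_ne_zero.1 hv
    rw [mem_filter] at he
    obtain ⟨q, hq⟩ := Sym2.mem_iff_exists.1 he.2
    have := hcrit e he.1
    push Not at this
    obtain ⟨a, ha, b, hb, hab⟩ := this
    refine ⟨a, ha, Linked.reachable_iff.2 ?_⟩
    exact ((Linked.erase_or_linked (ends := id) hq he.1 (hF.2 a ha b hb)).resolve_left hab).symm

theorem le_cost_of_linked (hc : ∀ e, 0 ≤ c e) {opt : ℝ}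
    (hopt : IsMinCostOf (IsSteinerTree E R) c opt) (hYE : Y ⊆ E)
    (hY : ∀ u ∈ R, ∀ v ∈ R, Linked id Y u v) : opt ≤ cost c Y := by
  obtain ⟨F, hFY, hF⟩ := exists_isSteinerTree_subset hYE hY
  exact (hopt.2 F hF).trans (cost_mono hc hFY)

end Cost

section Bridge

/-- The total weight of a family of weighted links. -/
def weight (T : Finset (Sym2 V × ℝ)) : ℝ := ∑ l ∈ T, l.2

variable {T : Finset (Sym2 V × ℝ)} {S S₁ S₂ R K : Finset V}

omit [Fintype V] [DecidableEq V] in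
theorem weight_mono {T' : Finset (Sym2 V × ℝ)} (h : T' ⊆ T) (hT : ∀ l ∈ T, 0 ≤ l.2) :
    weight T' ≤ weight T :=
  sum_le_sum_of_subset_of_nonneg h fun l hl _ => hT l hl

omit [Fintype V] in
theorem weight_union_le {T' : Finset (Sym2 V × ℝ)} (hT : ∀ l ∈ T, 0 ≤ l.2) :
    weight (T ∪ T') ≤ weight T + weight T' := by
  have := sum_union_inter (s₁ := T) (s₂ := T') (f := Prod.snd)
  have h : 0 ≤ ∑ l ∈ T ∩ T', l.2 := sum_nonneg fun l hl => hT l (mem_inter.1 hl).1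
  unfold weight
  linarith

/-- `b K` is the weight of links of `T` that become redundant in connecting `S` once the
vertices of `K` are identified, out of a total weight `W`; all weights being at most `M`,
the subtour constraints for `x` bound the total `∑ K, x K * b K` from below. -/
structure IsBridgeFunction (x : Finset V → ℝ) (T : Finset (Sym2 V × ℝ)) (S : Finset V)
    (b : Finset V → ℝ) (W : ℝ) : Prop where
  nonneg : ∀ K, 0 ≤ b K
  eq_zero : ∀ K, K ∩ S = ∅ → b K = 0
  exists_subset : ∀ K, (K ∩ S).Nonempty → ∃ T' ⊆ T, weight T' + b K ≤ W ∧
    ∀ v ∈ S, ∃ k ∈ K ∩ S, Linked Prod.fst T' k v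
  sum_le : ∀ M, (∀ l ∈ T, l.2 ≤ M) →
    ∑ K, x K * (M * ((#(K ∩ S) - 1 : ℕ) : ℝ) - b K) ≤ M * ((#S : ℝ) - 1) - W

theorem IsBridgeFunction.mono {x : Finset V → ℝ} {T' : Finset (Sym2 V × ℝ)} {b : Finset V → ℝ}
    {W : ℝ} (h : IsBridgeFunction x T S b W) (hT : T ⊆ T') : IsBridgeFunction x T' S b W where
  nonneg := h.nonneg
  eq_zero := h.eq_zero
  exists_subset K hK := by
    obtain ⟨U, hU, h₁, h₂⟩ := h.exists_subset K hK
    exact ⟨U, hU.trans hT, h₁, h₂⟩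
  sum_le M hM := h.sum_le M fun l hl => hM l (hT hl)

theorem IsBridgeFunction.join {x : Finset V → ℝ}
    (hsub : ∑ K, x K * ((#(K ∩ (S₁ ∪ S₂)) - 1 : ℕ) : ℝ) ≤ (#(S₁ ∪ S₂) : ℝ) - 1)
    (hdisj : Disjoint S₁ S₂) {T₁ T₂ : Finset (Sym2 V × ℝ)} {b₁ b₂ : Finset V → ℝ} {W₁ W₂ : ℝ}
    (h₁ : IsBridgeFunction x T₁ S₁ b₁ W₁) (h₂ : IsBridgeFunction x T₂ S₂ b₂ W₂)
    {p q : V} {m : ℝ} (hp : p ∈ S₁) (hq : q ∈ S₂) (hm : 0 ≤ m)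
    (hnonneg₁ : ∀ l ∈ T₁, 0 ≤ l.2)
    (hm₁ : ∀ l ∈ T₁, l.2 ≤ m) (hm₂ : ∀ l ∈ T₂, l.2 ≤ m) :
    IsBridgeFunction x (insert (s(p, q), m) (T₁ ∪ T₂)) (S₁ ∪ S₂)
      (fun K => b₁ K + b₂ K + if (K ∩ S₁).Nonempty ∧ (K ∩ S₂).Nonempty then m else 0)
      (W₁ + W₂ + m) where
  nonneg K := by
    have := h₁.nonneg K
    have := h₂.nonneg K
    split_ifs <;> positivity
  eq_zero K hK := by
    rw [inter_union_distrib_left, union_eq_empty] at hK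
    simp [h₁.eq_zero K hK.1, h₂.eq_zero K hK.2, hK.1]
  exists_subset K hK := by
    have hnonneg : ∀ T₁' ⊆ T₁, ∀ l ∈ T₁', 0 ≤ l.2 := fun T₁' h l hl => hnonneg₁ l (h hl)
    have hlink : ∀ U : Finset (Sym2 V × ℝ), Linked Prod.fst (insert (s(p, q), m) U) p q :=
      fun U => Linked.of_mem (mem_insert_self _ _) rfl
    have hins : ∀ U : Finset (Sym2 V × ℝ), weight (insert (s(p, q), m) U) ≤ m + weight U := by
      intro U
      have := weight_union_le (T := {(s(p, q), m)}) (T' := U) (by simpa using hm)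
      have hsingle : weight {(s(p, q), m)} = m := sum_singleton _ _
      rwa [hsingle, ← insert_eq] at this
    by_cases hK₁ : (K ∩ S₁).Nonempty <;> by_cases hK₂ : (K ∩ S₂).Nonempty
    · obtain ⟨U₁, hU₁, hw₁, hc₁⟩ := h₁.exists_subset K hK₁
      obtain ⟨U₂, hU₂, hw₂, hc₂⟩ := h₂.exists_subset K hK₂
      refine ⟨U₁ ∪ U₂, (union_subset_union hU₁ hU₂).trans (subset_insert _ _), ?_, ?_⟩
      · have := weight_union_le (T' := U₂) (hnonneg U₁ hU₁)
        simp only [hK₁, hK₂, and_self, if_true]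
        linarith
      · intro v hv
        obtain hv | hv := mem_union.1 hv
        · obtain ⟨k, hk, hkv⟩ := hc₁ v hv
          exact ⟨k, inter_subset_inter_left subset_union_left hk, hkv.mono subset_union_left⟩
        · obtain ⟨k, hk, hkv⟩ := hc₂ v hv
          exact ⟨k, inter_subset_inter_left subset_union_right hk, hkv.mono subset_union_right⟩
    · obtain ⟨U₁, hU₁, hw₁, hc₁⟩ := h₁.exists_subset K hK₁
      obtain ⟨U₂, hU₂, hw₂, hc₂⟩ := h₂.exists_subset {q} ⟨q, by simpa using hq⟩
      have hs₁ : U₁ ⊆ insert (s(p, q), m) (U₁ ∪ U₂) :=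
        subset_union_left.trans (subset_insert _ _)
      have hs₂ : U₂ ⊆ insert (s(p, q), m) (U₁ ∪ U₂) :=
        subset_union_right.trans (subset_insert _ _)
      refine ⟨_, insert_subset_insert (s(p, q), m) (union_subset_union hU₁ hU₂), ?_, ?_⟩
      · have := weight_union_le (T' := U₂) (hnonneg U₁ hU₁)
        have := hins (U₁ ∪ U₂)
        have := h₂.nonneg {q}
        simp only [hK₂, and_false, if_false, h₂.eq_zero K (not_nonempty_iff_eq_empty.1 hK₂)]
        linarith
      · intro v hv
        obtain hv | hv := mem_union.1 hv
        · obtain ⟨k, hk, hkv⟩ := hc₁ v hv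
          exact ⟨k, inter_subset_inter_left subset_union_left hk, hkv.mono hs₁⟩
        · obtain ⟨k, hk, hkp⟩ := hc₁ p hp
          obtain ⟨k', hk', hkv⟩ := hc₂ v hv
          obtain rfl : k' = q := by simpa using (mem_inter.1 hk').1
          exact ⟨k, inter_subset_inter_left subset_union_left hk,
            ((hkp.mono hs₁).trans (hlink _)).trans (hkv.mono hs₂)⟩
    · obtain ⟨U₁, hU₁, hw₁, hc₁⟩ := h₁.exists_subset {p} ⟨p, by simpa using hp⟩
      obtain ⟨U₂, hU₂, hw₂, hc₂⟩ := h₂.exists_subset K hK₂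
      have hs₁ : U₁ ⊆ insert (s(p, q), m) (U₁ ∪ U₂) :=
        subset_union_left.trans (subset_insert _ _)
      have hs₂ : U₂ ⊆ insert (s(p, q), m) (U₁ ∪ U₂) :=
        subset_union_right.trans (subset_insert _ _)
      refine ⟨_, insert_subset_insert (s(p, q), m) (union_subset_union hU₁ hU₂), ?_, ?_⟩
      · have := weight_union_le (T' := U₂) (hnonneg U₁ hU₁)
        have := hins (U₁ ∪ U₂)
        have := h₁.nonneg {p}
        simp only [hK₁, false_and, if_false, h₁.eq_zero K (not_nonempty_iff_eq_empty.1 hK₁)]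
        linarith
      · intro v hv
        obtain hv | hv := mem_union.1 hv
        · obtain ⟨k, hk, hkq⟩ := hc₂ q hq
          obtain ⟨k', hk', hkv⟩ := hc₁ v hv
          obtain rfl : k' = p := by simpa using (mem_inter.1 hk').1
          exact ⟨k, inter_subset_inter_left subset_union_right hk,
            ((hkq.mono hs₂).trans (hlink _).symm).trans (hkv.mono hs₁)⟩
        · obtain ⟨k, hk, hkv⟩ := hc₂ v hv
          exact ⟨k, inter_subset_inter_left subset_union_right hk, hkv.mono hs₂⟩
    · rw [inter_union_distrib_left, not_nonempty_iff_eq_empty.1 hK₁,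
        not_nonempty_iff_eq_empty.1 hK₂, union_empty] at hK
      exact absurd hK not_nonempty_empty
  sum_le M hM := by
    have hmM : m ≤ M := hM _ (mem_insert_self _ _)
    have hcard : ∀ K, ((#(K ∩ (S₁ ∪ S₂)) - 1 : ℕ) : ℝ) = ((#(K ∩ S₁) - 1 : ℕ) : ℝ) +
        ((#(K ∩ S₂) - 1 : ℕ) : ℝ) +
        if (K ∩ S₁).Nonempty ∧ (K ∩ S₂).Nonempty then 1 else 0 := by
      intro K
      have hd : Disjoint (K ∩ S₁) (K ∩ S₂) :=
        hdisj.mono inter_subset_right inter_subset_right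
      rw [inter_union_distrib_left, card_union_of_disjoint hd]
      simp only [← card_pos]
      split_ifs with h
      · obtain ⟨h, h'⟩ := h
        norm_cast
        omega
      · norm_cast
        omega
    have hsum := add_le_add (h₁.sum_le m hm₁) (h₂.sum_le m hm₂)
    rw [← sum_add_distrib] at hsum
    have hkey : ∑ K, x K * (M * ((#(K ∩ (S₁ ∪ S₂)) - 1 : ℕ) : ℝ) - (b₁ K + b₂ K +
          if (K ∩ S₁).Nonempty ∧ (K ∩ S₂).Nonempty then m else 0)) =
        ∑ K, (x K * (m * ((#(K ∩ S₁) - 1 : ℕ) : ℝ) - b₁ K) +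
          x K * (m * ((#(K ∩ S₂) - 1 : ℕ) : ℝ) - b₂ K)) +
        (M - m) * ∑ K, x K * ((#(K ∩ (S₁ ∪ S₂)) - 1 : ℕ) : ℝ) := by
      rw [mul_sum, ← sum_add_distrib]
      refine sum_congr rfl fun K _ => ?_
      rw [hcard K]
      split_ifs <;> ring
    have hS : (#(S₁ ∪ S₂) : ℝ) = #S₁ + #S₂ := by
      rw [card_union_of_disjoint hdisj]
      push_cast
      ring
    have := mul_le_mul_of_nonneg_left hsub (sub_nonneg.2 hmM)
    rw [hkey]
    rw [hS] at this ⊢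
    linarith

theorem exists_isBridgeFunction {x : Finset V → ℝ}
    (hsub : ∀ S ⊆ R, S.Nonempty →
      ∑ K, x K * ((#(K ∩ S) - 1 : ℕ) : ℝ) ≤ (#S : ℝ) - 1) (hT : ∀ l ∈ T, 0 ≤ l.2)
    (hSR : S ⊆ R) (hS : S.Nonempty) (hends : ∀ l ∈ T, ∀ v ∈ l.1, v ∈ S)
    (hconn : ∀ u ∈ S, ∀ v ∈ S, Linked Prod.fst T u v) :
    ∃ b W, W ≤ weight T ∧ IsBridgeFunction x T S b W := by
  classical
  induction h : #T using Nat.strong_induction_on generalizing T S with | _ n ih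
  subst h
  obtain rfl | hne := T.eq_empty_or_nonempty
  · obtain ⟨v, rfl⟩ : ∃ v, S = {v} := by
      obtain ⟨v, hv⟩ := hS
      refine ⟨v, eq_singleton_iff_unique_mem.2 ⟨hv, fun u hu => ?_⟩⟩
      have := hconn u hu v hv
      rcases this.cases_head with h | ⟨w, ⟨e, he, -⟩, -⟩
      · exact h
      · simp at he
    refine ⟨fun _ => 0, 0, by simp [weight], fun _ => le_rfl, fun _ _ => rfl, fun K hK => ?_,
      fun M _ => ?_⟩
    · refine ⟨∅, by simp, by simp [weight], fun u hu => ⟨u, ?_, Linked.refl _⟩⟩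
      obtain ⟨k, hk⟩ := hK
      rw [mem_singleton] at hu
      rw [mem_inter, mem_singleton] at hk
      simp [hu, ← hk.2, hk.1]
    · refine le_of_eq ?_
      have : ∀ K : Finset V, #(K ∩ {v}) - 1 = 0 := fun K => by
        have := card_le_card (inter_subset_right (s₁ := K) (s₂ := {v}))
        simp only [card_singleton] at this
        omega
      simp [this]
  obtain ⟨e, he, hmax⟩ := exists_max_image T Prod.snd hne
  obtain ⟨p, q, hpq⟩ : ∃ p q, e.1 = s(p, q) := by
    induction h : e.1 with | _ a b => exact ⟨a, b, rfl⟩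
  have hpS : p ∈ S := hends e he p (by simp [hpq])
  have hqS : q ∈ S := hends e he q (by simp [hpq])
  have hcard := card_erase_lt_of_mem he
  by_cases hlink : Linked Prod.fst (T.erase e) p q
  · obtain ⟨b, W, hW, hb⟩ := ih _ hcard (fun l hl => hT l (mem_of_mem_erase hl)) hSR hS
      (fun l hl => hends l (mem_of_mem_erase hl))
      (fun u hu v hv => Linked.erase_of_linked hpq hlink (hconn u hu v hv)) rfl
    exact ⟨b, W, hW.trans (weight_mono (erase_subset _ _) hT), hb.mono (erase_subset _ _)⟩
  have hpart : ∀ r ∈ S, ∃ b W, W ≤ weight (linkComponent Prod.fst (T.erase e) r) ∧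
      IsBridgeFunction x (linkComponent Prod.fst (T.erase e) r)
        (S.filter fun v => Linked Prod.fst (T.erase e) r v) b W := by
    intro r hr
    have hsubT : linkComponent Prod.fst (T.erase e) r ⊆ T :=
      linkComponent_subset.trans (erase_subset _ _)
    refine ih _ ((card_le_card linkComponent_subset).trans_lt hcard)
      (fun l hl => hT l (hsubT hl)) ((filter_subset _ _).trans hSR)
      ⟨r, by simp [hr, Linked.refl]⟩ (fun l hl v hv => ?_) (fun u hu v hv => ?_) rfl
    · exact mem_filter.2 ⟨hends l (hsubT hl) v hv, (mem_linkComponent.1 hl).2 v hv⟩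
    · exact (mem_filter.1 hu).2.linkComponent.symm.trans (mem_filter.1 hv).2.linkComponent
  obtain ⟨b₁, W₁, hW₁, hb₁⟩ := hpart p hpS
  obtain ⟨b₂, W₂, hW₂, hb₂⟩ := hpart q hqS
  have hunion : (S.filter fun v => Linked Prod.fst (T.erase e) p v) ∪
      (S.filter fun v => Linked Prod.fst (T.erase e) q v) = S := by
    rw [← filter_or, filter_eq_self]
    exact fun v hv => Linked.erase_or_erase hpq (hconn p hpS v hv)
  have hdisj : Disjoint (S.filter fun v => Linked Prod.fst (T.erase e) p v)
      (S.filter fun v => Linked Prod.fst (T.erase e) q v) := by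
    rw [disjoint_filter]
    exact fun v _ h h' => hlink (h.trans h'.symm)
  have hsubset : ∀ r, linkComponent Prod.fst (T.erase e) r ⊆ T := fun r =>
    linkComponent_subset.trans (erase_subset _ _)
  have hjoin := IsBridgeFunction.join (by rw [hunion]; exact hsub S hSR hS) hdisj hb₁ hb₂
    (mem_filter.2 ⟨hpS, Linked.refl _⟩) (mem_filter.2 ⟨hqS, Linked.refl _⟩) (hT e he)
    (fun l hl => hT l (hsubset p hl))
    (fun l hl => hmax l (hsubset p hl)) (fun l hl => hmax l (hsubset q hl))
  rw [hunion] at hjoin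
  have hsum := sum_linkComponent_le he Prod.snd hT hlink
  refine ⟨_, _, ?_, hjoin.mono (insert_subset ?_ (union_subset (hsubset p) (hsubset q)))⟩
  · unfold weight at *
    linarith
  · rw [← hpq]
    exact he

end Bridge

section Component

variable {E X : Finset (Sym2 V)} {c : Sym2 V → ℝ} {R S K : Finset V} {T : Finset (Sym2 V × ℝ)}

/-- `T` is a family of weighted links between terminals, connecting `S`, each of which can be
realized in the graph at a cost bounded by its weight once the edges of `X` are bought. -/
structure IsLinkSystem (E : Finset (Sym2 V)) (c : Sym2 V → ℝ) (R S : Finset V)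
    (X : Finset (Sym2 V)) (T : Finset (Sym2 V × ℝ)) : Prop where
  subset : X ⊆ E
  mem_terminals : ∀ l ∈ T, ∀ v ∈ l.1, v ∈ R
  realizable : ∀ l ∈ T, ∃ P ⊆ E, cost c P ≤ l.2 ∧
    ∀ u v, l.1 = s(u, v) → Linked id (X ∪ P) u v
  linked : ∀ u ∈ S, ∀ v ∈ S, Linked Prod.fst T u v

namespace IsLinkSystem

omit [Fintype V]

theorem nonneg (hc : ∀ e, 0 ≤ c e) (h : IsLinkSystem E c R S X T) : ∀ l ∈ T, 0 ≤ l.2 := by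
  intro l hl
  obtain ⟨P, -, hP, -⟩ := h.realizable l hl
  exact (cost_nonneg hc P).trans hP

theorem realizable_union {X' : Finset (Sym2 V)} (h : IsLinkSystem E c R S X T) (hX : X ⊆ X') :
    ∀ l ∈ T, ∃ P ⊆ E, cost c P ≤ l.2 ∧ ∀ u v, l.1 = s(u, v) → Linked id (X' ∪ P) u v := by
  intro l hl
  obtain ⟨P, hPE, hP, hlink⟩ := h.realizable l hl
  exact ⟨P, hPE, hP, fun u v huv => (hlink u v huv).mono (union_subset_union_left hX)⟩

theorem join {X' X'' : Finset (Sym2 V)} {T' : Finset (Sym2 V × ℝ)} {S' : Finset V}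
    (h : IsLinkSystem E c R S X T) (h' : IsLinkSystem E c R S' X' T') {s s' : V} {a : ℝ}
    (hs : s ∈ S) (hs' : s' ∈ S') (hsR : s ∈ R) (hs'R : s' ∈ R) (hX'' : X'' ⊆ E) (hX : X ⊆ X'')
    (hX' : X' ⊆ X'')
    (hreal : ∃ P ⊆ E, cost c P ≤ a ∧ Linked id (X'' ∪ P) s s') :
    IsLinkSystem E c R (S ∪ S') X'' (insert (s(s, s'), a) (T ∪ T')) where
  subset := hX''
  mem_terminals l hl v hv := by
    rw [mem_insert, mem_union] at hl
    obtain rfl | hl | hl := hl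
    · rw [Sym2.mem_iff] at hv
      obtain rfl | rfl := hv <;> assumption
    · exact h.mem_terminals l hl v hv
    · exact h'.mem_terminals l hl v hv
  realizable l hl := by
    rw [mem_insert, mem_union] at hl
    obtain rfl | hl | hl := hl
    · obtain ⟨P, hPE, hP, hlink⟩ := hreal
      refine ⟨P, hPE, hP, fun u v huv => ?_⟩
      obtain ⟨rfl, rfl⟩ | ⟨rfl, rfl⟩ := Sym2.eq_iff.1 huv
      · exact hlink
      · exact hlink.symm
    · exact h.realizable_union hX l hl
    · exact h'.realizable_union hX' l hl
  linked := by
    have hs : ∀ u ∈ S ∪ S', Linked Prod.fst (insert (s(s, s'), a) (T ∪ T')) s u := by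
      intro u hu
      obtain hu | hu := mem_union.1 hu
      · exact (h.linked s hs u hu).mono (subset_union_left.trans (subset_insert _ _))
      · have hss' : Linked Prod.fst (insert (s(s, s'), a) (T ∪ T')) s s' :=
          Linked.of_mem (mem_insert_self _ _) rfl
        exact hss'.trans
          ((h'.linked s' hs' u hu).mono (subset_union_right.trans (subset_insert _ _)))
    exact fun u hu v hv => (hs u hu).symm.trans (hs v hv)

theorem exists_cost_le (hc : ∀ e, 0 ≤ c e) (h : IsLinkSystem E c R S X T) :
    ∃ Y ⊆ E, cost c Y ≤ weight T + cost c X ∧ ∀ u ∈ S, ∀ v ∈ S, Linked id Y u v := by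
  have hreal := h.realizable
  choose! P hPE hP hlink using hreal
  refine ⟨X ∪ T.biUnion P, union_subset h.subset (biUnion_subset.2 hPE), ?_, ?_⟩
  · have hbi : ∀ T : Finset (Sym2 V × ℝ), cost c (T.biUnion P) ≤ ∑ l ∈ T, cost c (P l) := by
      intro T
      induction T using Finset.induction_on with
      | empty => simp [cost]
      | insert l T hl ih =>
        rw [biUnion_insert, sum_insert hl]
        exact (cost_union_le hc _ _).trans (by gcongr)
    have h₁ := cost_union_le hc X (T.biUnion P)
    have h₂ : cost c (T.biUnion P) ≤ weight T :=
      (hbi T).trans (sum_le_sum hP)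
    linarith
  · intro u hu v hv
    refine (h.linked u hu v hv).lift fun l hl a b hab => ?_
    exact (hlink l hl a b hab).mono
      (union_subset_union_right (subset_biUnion_of_mem P hl))

end IsLinkSystem

/-- `Rooted E c R r K a`: a tree of cost `a` in the graph, rooted at `r`, connects `r` to the
terminals in `K`. -/
inductive Rooted (E : Finset (Sym2 V)) (c : Sym2 V → ℝ) (R : Finset V) :
    V → Finset V → ℝ → Prop
  | terminal (r : V) : r ∈ R → Rooted E c R r {r} 0
  | extend (r q : V) (K : Finset V) (a : ℝ) : s(r, q) ∈ E → Rooted E c R q K a →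
      Rooted E c R r K (a + c s(r, q))
  | join (r : V) (K K' : Finset V) (a a' : ℝ) : Rooted E c R r K a → Rooted E c R r K' a' →
      Rooted E c R r (K ∪ K') (a + a')

omit [Fintype V] in
theorem exists_rooted (hc : ∀ e, 0 ≤ c e) {F : Finset (Sym2 V)} (hFE : F ⊆ E) (hKR : K ⊆ R)
    (hK : K.Nonempty) {r : V} (hlink : ∀ k ∈ K, Linked id F r k) :
    ∃ a ≤ cost c F, Rooted E c R r K a := by
  classical
  induction h : #F using Nat.strong_induction_on generalizing F K r with | _ n ih
  subst h
  by_cases hKr : K ⊆ {r}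
  · obtain rfl : K = {r} := hK.subset_singleton_iff.1 hKr
    exact ⟨0, cost_nonneg hc F, .terminal r (hKR (mem_singleton_self r))⟩
  obtain ⟨k, hk, hkr⟩ : ∃ k ∈ K, k ≠ r := by
    simpa [subset_iff] using hKr
  obtain ⟨q, hq⟩ : ∃ q, s(r, q) ∈ F := by
    rcases (hlink k hk).cases_head with h | ⟨w, ⟨e, he, hew⟩, -⟩
    · exact absurd h.symm hkr
    · exact ⟨w, hew ▸ he⟩
  have hcard := card_erase_lt_of_mem hq
  by_cases hrq : Linked id (F.erase s(r, q)) r q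
  · obtain ⟨a, ha, hroot⟩ := ih _ hcard ((erase_subset _ _).trans hFE) hKR hK
      (fun k hk => Linked.erase_of_linked (ends := id) rfl hrq (hlink k hk)) rfl
    exact ⟨a, ha.trans (cost_mono hc (erase_subset _ _)), hroot⟩
  have hpart : ∀ p, (K.filter fun v => Linked id (F.erase s(r, q)) p v).Nonempty →
      ∃ a ≤ cost c (linkComponent id (F.erase s(r, q)) p),
        Rooted E c R p (K.filter fun v => Linked id (F.erase s(r, q)) p v) a := by
    intro p hp
    exact ih _ ((card_le_card linkComponent_subset).trans_lt hcard)
      ((linkComponent_subset.trans (erase_subset _ _)).trans hFE)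
      ((filter_subset _ _).trans hKR) hp (fun k hk => (mem_filter.1 hk).2.linkComponent) rfl
  have hunion : (K.filter fun v => Linked id (F.erase s(r, q)) r v) ∪
      (K.filter fun v => Linked id (F.erase s(r, q)) q v) = K := by
    rw [← filter_or, filter_eq_self]
    exact fun v hv => Linked.erase_or_erase (ends := id) rfl (hlink v hv)
  have hsum : cost c _ + cost c _ + c s(r, q) ≤ cost c F :=
    sum_linkComponent_le hq c (fun e _ => hc e) hrq
  have h₁ := cost_nonneg hc (linkComponent id (F.erase s(r, q)) r)
  have h₂ := cost_nonneg hc (linkComponent id (F.erase s(r, q)) q)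
  have h₃ := hc s(r, q)
  by_cases hr : (K.filter fun v => Linked id (F.erase s(r, q)) r v).Nonempty
  · obtain ⟨a, ha, hra⟩ := hpart r hr
    by_cases hq' : (K.filter fun v => Linked id (F.erase s(r, q)) q v).Nonempty
    · obtain ⟨b, hb, hqb⟩ := hpart q hq'
      refine ⟨a + (b + c s(r, q)), by linarith, ?_⟩
      rw [← hunion]
      exact .join r _ _ _ _ hra (.extend r q _ _ (hFE hq) hqb)
    · rw [not_nonempty_iff_eq_empty.1 hq', union_empty] at hunion
      rw [hunion] at hra
      exact ⟨a, by linarith, hra⟩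
  · rw [not_nonempty_iff_eq_empty.1 hr, empty_union] at hunion
    obtain ⟨b, hb, hqb⟩ := hpart q (by rwa [hunion])
    rw [hunion] at hqb
    exact ⟨b + c s(r, q), by linarith, .extend r q _ _ (hFE hq) hqb⟩

namespace Rooted

omit [Fintype V]

theorem subset_terminals {r : V} {a : ℝ} (h : Rooted E c R r K a) : K ⊆ R := by
  induction h with
  | terminal r hr => simpa using hr
  | extend _ _ _ _ _ _ ih => exact ih
  | join _ _ _ _ _ _ _ ih ih' => exact union_subset ih ih'

theorem linkSystem_singleton (r : V) (hX : X ⊆ E) : IsLinkSystem E c R {r} X ∅ where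
  subset := hX
  mem_terminals := by simp
  realizable := by simp
  linked u hu v hv := by
    rw [mem_singleton] at hu hv
    subst hu hv
    exact Linked.refl _

theorem weight_insert_le {l : Sym2 V × ℝ} {T' : Finset (Sym2 V × ℝ)} (hl : 0 ≤ l.2)
    (hT : ∀ l ∈ T, 0 ≤ l.2) : weight (insert l (T ∪ T')) ≤ l.2 + weight T + weight T' := by
  have h₁ := weight_union_le (T := {l}) (T' := T ∪ T') (by simpa using hl)
  have h₂ := weight_union_le (T' := T') hT
  have hsingle : weight {l} = l.2 := sum_singleton _ _
  rw [hsingle, ← insert_eq] at h₁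
  linarith

/-- Doubling a rooted tree yields terminal links of total weight at most twice its cost. -/
theorem exists_doubling (hc : ∀ e, 0 ≤ c e) {r : V} {a : ℝ} (h : Rooted E c R r K a) :
    ∃ T Q t, t ∈ K ∧ Q ⊆ E ∧ Linked id Q r t ∧ IsLinkSystem E c R K ∅ T ∧
      weight T + 2 * cost c Q ≤ 2 * a := by
  induction h with
  | terminal r hr =>
    exact ⟨∅, ∅, r, by simp, by simp, Linked.refl _, linkSystem_singleton r (by simp),
      by simp [weight, cost]⟩
  | extend r q K a hrq _ ih =>
    obtain ⟨T, Q, t, ht, hQ, hlink, hT, hle⟩ := ih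
    refine ⟨T, {s(r, q)} ∪ Q, t, ht, union_subset (by simpa using hrq) hQ, ?_, hT, ?_⟩
    · have hrq' : Linked id ({s(r, q)} ∪ Q) r q := Linked.of_mem (e := s(r, q)) (by simp) rfl
      exact hrq'.trans (hlink.mono subset_union_right)
    · have h₁ := cost_union_le hc {s(r, q)} Q
      have h₂ : cost c {s(r, q)} = c s(r, q) := sum_singleton _ _
      linarith
  | join r K K' a a' h h' ih ih' =>
    obtain ⟨T, Q, t, ht, hQ, hlink, hT, hle⟩ := ih
    obtain ⟨T', Q', t', ht', hQ', hlink', hT', hle'⟩ := ih'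
    have hQc := cost_nonneg hc Q
    have hQc' := cost_nonneg hc Q'
    have hsys : IsLinkSystem E c R (K ∪ K') ∅
        (insert (s(t, t'), cost c Q + cost c Q') (T ∪ T')) := by
      refine hT.join hT' ht ht' (h.subset_terminals ht) (h'.subset_terminals ht')
        (empty_subset _) (empty_subset _) (empty_subset _)
        ⟨Q ∪ Q', union_subset hQ hQ', cost_union_le hc _ _, ?_⟩
      rw [empty_union]
      exact (hlink.symm.mono subset_union_left).trans (hlink'.mono subset_union_right)
    have hw : weight (insert (s(t, t'), cost c Q + cost c Q') (T ∪ T')) ≤ _ :=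
      weight_insert_le (add_nonneg hQc hQc') (hT.nonneg hc)
    simp only at hw
    obtain hQQ' | hQQ' := le_total (cost c Q) (cost c Q')
    · exact ⟨_, Q, t, mem_union_left _ ht, hQ, hlink, hsys, by linarith⟩
    · exact ⟨_, Q', t', mem_union_right _ ht', hQ', hlink', hsys, by linarith⟩

/-- Contracting the loss `X` of a rooted tree: the remaining edges become terminal links. -/
theorem exists_loss (hc : ∀ e, 0 ≤ c e) {r : V} {a : ℝ} (h : Rooted E c R r K a) :
    ∃ X T Q t d, t ∈ K ∧ Q ⊆ E ∧ Linked id (X ∪ Q) r t ∧ IsLinkSystem E c R K X T ∧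
      weight T ≤ d ∧ d + cost c X + cost c Q ≤ a ∧ cost c X ≤ d := by
  induction h with
  | terminal r hr =>
    exact ⟨∅, ∅, ∅, r, 0, by simp, by simp, Linked.refl _, linkSystem_singleton r (by simp),
      by simp [weight], by simp [cost], by simp [cost]⟩
  | extend r q K a hrq _ ih =>
    obtain ⟨X, T, Q, t, d, ht, hQ, hlink, hT, hd, hle, hX⟩ := ih
    refine ⟨X, T, {s(r, q)} ∪ Q, t, d, ht, union_subset (by simpa using hrq) hQ, ?_, hT, hd, ?_,
      hX⟩
    · have hrq' : Linked id (X ∪ ({s(r, q)} ∪ Q)) r q :=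
        Linked.of_mem (e := s(r, q)) (by simp) rfl
      exact hrq'.trans (hlink.mono (union_subset_union_right subset_union_right))
    · have h₁ := cost_union_le hc {s(r, q)} Q
      have h₂ : cost c {s(r, q)} = c s(r, q) := sum_singleton _ _
      linarith
  | join r K K' a a' h h' ih ih' =>
    obtain ⟨X, T, Q, t, d, ht, hQ, hlink, hT, hd, hle, hX⟩ := ih
    obtain ⟨X', T', Q', t', d', ht', hQ', hlink', hT', hd', hle', hX'⟩ := ih'
    wlog hQQ' : cost c Q ≤ cost c Q' generalizing K K' a a' X T Q t d X' T' Q' t' d'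
    · rw [union_comm, add_comm a]
      exact this K' K a' a h' h X' T' Q' t' d' ht' hQ' hlink' hT' hd' hle' hX' X T Q t d ht hQ
        hlink hT hd hle hX (not_le.1 hQQ').le
    have hXQ : X ∪ Q ⊆ X ∪ X' ∪ Q := union_subset_union_left subset_union_left
    have hcost : cost c (X ∪ X' ∪ Q) ≤ cost c X + cost c X' + cost c Q :=
      (cost_union_le hc _ _).trans (by gcongr; exact cost_union_le hc _ _)
    have hsys : IsLinkSystem E c R (K ∪ K') (X ∪ X' ∪ Q)
        (insert (s(t, t'), cost c Q') (T ∪ T')) := by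
      refine hT.join hT' ht ht' (h.subset_terminals ht) (h'.subset_terminals ht')
        (union_subset (union_subset hT.subset hT'.subset) hQ)
        (subset_union_left.trans subset_union_left)
        (subset_union_right.trans subset_union_left) ⟨Q', hQ', le_rfl, ?_⟩
      exact (hlink.symm.mono (hXQ.trans subset_union_left)).trans (hlink'.mono
        (union_subset_union_left (subset_union_right.trans subset_union_left)))
    have hw : weight (insert (s(t, t'), cost c Q') (T ∪ T')) ≤ _ :=
      weight_insert_le (cost_nonneg hc Q') (hT.nonneg hc)
    simp only at hw
    have hempty : cost c ∅ = 0 := sum_empty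
    exact ⟨X ∪ X' ∪ Q, _, ∅, t, cost c Q' + d + d', mem_union_left _ ht, empty_subset _,
      hlink.mono (hXQ.trans subset_union_left), hsys, by linarith, by linarith, by linarith⟩

end Rooted

end Component

section Rounding

variable {E X : Finset (Sym2 V)} {c : Sym2 V → ℝ} {R : Finset V} {x : Finset V → ℝ}
  {T : Finset (Sym2 V × ℝ)}

theorem LPFeasible.sum_le (hx : LPFeasible E R x) {S : Finset V} (hSR : S ⊆ R)
    (hS : S.Nonempty) : ∑ K, x K * ((#(K ∩ S) - 1 : ℕ) : ℝ) ≤ (#S : ℝ) - 1 := by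
  refine le_trans (le_of_eq ?_) (hx.2.2.1 S hSR hS)
  rw [sum_filter]
  refine sum_congr rfl fun K _ => ?_
  split_ifs with h
  · rw [Nat.cast_sub (card_pos.2 h), Nat.cast_one]
  · simp [not_nonempty_iff_eq_empty.1 h]

theorem LPFeasible.nonempty_terminals (hx : LPFeasible E R x) : R.Nonempty := by
  by_contra hR
  rw [not_nonempty_iff_eq_empty] at hR
  subst hR
  have h : 0 ≤ ∑ K, x K * ((#K : ℝ) - 1) := by
    refine sum_nonneg fun K _ => ?_
    by_cases hK : x K = 0
    · simp [hK]
    · have : (2 : ℝ) ≤ #K := by exact_mod_cast (hx.2.1 K hK).2.1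
      exact mul_nonneg (hx.1 K) (by linarith)
  have := hx.2.2.2
  simp only [card_empty, Nat.cast_zero] at this
  linarith

/-- Adding a component on `K` to a connecting link system saves `b K`, and by the LP
constraints the average saving pays for the whole system. -/
theorem LPFeasible.exists_exchange (hc : ∀ e, 0 ≤ c e) (hx : LPFeasible E R x)
    (hT : IsLinkSystem E c R R X T) :
    ∃ (b : Finset V → ℝ) (W : ℝ), W ≤ weight T ∧ W ≤ ∑ K, x K * b K ∧
      (∃ T₀, IsLinkSystem E c R R X T₀ ∧ weight T₀ ≤ W) ∧
      ∀ K, x K ≠ 0 → ∀ X' D, IsLinkSystem E c R K X' D →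
        ∃ T', IsLinkSystem E c R R (X ∪ X') T' ∧ weight T' ≤ W - b K + weight D := by
  obtain ⟨b, W, hW, hb⟩ := exists_isBridgeFunction (x := x) (fun S hSR hS => hx.sum_le hSR hS)
    (hT.nonneg hc) Subset.rfl hx.nonempty_terminals hT.mem_terminals hT.linked
  refine ⟨b, W, hW, ?_, ?_, ?_⟩
  · obtain ⟨M, hM⟩ : ∃ M, ∀ l ∈ T, l.2 ≤ M := by
      obtain ⟨M, hM⟩ := (T.image Prod.snd).bddAbove
      exact ⟨M, fun l hl => hM (by simpa using ⟨l.1, hl⟩)⟩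
    have h := hb.sum_le M hM
    have heq : ∑ K, x K * (M * ((#(K ∩ R) - 1 : ℕ) : ℝ) - b K) =
        M * ∑ K, x K * ((#K : ℝ) - 1) - ∑ K, x K * b K := by
      rw [mul_sum, ← sum_sub_distrib]
      refine sum_congr rfl fun K _ => ?_
      by_cases hK : x K = 0
      · simp [hK]
      · obtain ⟨hKR, hcard, -⟩ := hx.2.1 K hK
        rw [inter_eq_left.2 hKR, Nat.cast_sub (by omega)]
        push_cast
        ring
    rw [heq, hx.2.2.2] at h
    linarith
  · obtain ⟨r, hr⟩ := hx.nonempty_terminals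
    obtain ⟨T₀, hT₀, hw, hlink⟩ := hb.exists_subset {r} ⟨r, by simpa using hr⟩
    refine ⟨T₀, ⟨hT.subset, fun l hl => hT.mem_terminals l (hT₀ hl),
      fun l hl => hT.realizable l (hT₀ hl), ?_⟩, ?_⟩
    · have hlink' : ∀ v ∈ R, Linked Prod.fst T₀ r v := by
        intro v hv
        obtain ⟨k, hk, hkv⟩ := hlink v hv
        rw [mem_inter, mem_singleton] at hk
        exact hk.1 ▸ hkv
      exact fun u hu v hv => (hlink' u hu).symm.trans (hlink' v hv)
    · have := hb.nonneg {r}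
      linarith
  · intro K hK X' D hD
    obtain ⟨hKR, hcard, -⟩ := hx.2.1 K hK
    have hne : (K ∩ R).Nonempty := by
      rw [inter_eq_left.2 hKR, ← card_pos]
      omega
    obtain ⟨T', hT', hw, hlink⟩ := hb.exists_subset K hne
    refine ⟨T' ∪ D, ⟨union_subset hT.subset hD.subset, ?_, ?_, ?_⟩, ?_⟩
    · intro l hl
      obtain hl | hl := mem_union.1 hl
      · exact hT.mem_terminals l (hT' hl)
      · exact hD.mem_terminals l hl
    · intro l hl
      obtain hl | hl := mem_union.1 hl
      · exact hT.realizable_union subset_union_left l (hT' hl)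
      · exact hD.realizable_union subset_union_right l hl
    · intro u hu v hv
      obtain ⟨k, hk, hku⟩ := hlink u hu
      obtain ⟨k', hk', hkv⟩ := hlink v hv
      exact ((hku.mono subset_union_left).symm.trans
        ((hD.linked k (mem_inter.1 hk).1 k' (mem_inter.1 hk').1).mono
          subset_union_right)).trans (hkv.mono subset_union_left)
    · have := weight_union_le (T := T') (T' := D) fun l hl => hT.nonneg hc l (hT' hl)
      linarith

/-- Up to an arbitrarily small error, the terminals are connected by links of total weight at
most twice the LP value. -/
theorem LPFeasible.exists_weight_le (hc : ∀ e, 0 ≤ c e) (hx : LPFeasible E R x)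
    {C : Finset V → ℝ} (hT : IsLinkSystem E c R R ∅ T)
    (hC : ∀ K, x K ≠ 0 → ∃ D, IsLinkSystem E c R K ∅ D ∧ weight D ≤ 2 * C K) {δ : ℝ}
    (hδ : 0 < δ) :
    ∃ T', IsLinkSystem E c R R ∅ T' ∧ weight T' ≤ 2 * ∑ K, C K * x K + δ := by
  set A : Set ℝ := {w | ∃ T', IsLinkSystem E c R R ∅ T' ∧ weight T' = w} with hA
  have hAne : A.Nonempty := ⟨_, T, hT, rfl⟩
  have hAbdd : BddBelow A := by
    refine ⟨0, ?_⟩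
    rintro _ ⟨T', hT', rfl⟩
    exact sum_nonneg (hT'.nonneg hc)
  have hle : ∀ T', IsLinkSystem E c R R ∅ T' → sInf A ≤ weight T' := fun T' hT' =>
    csInf_le hAbdd ⟨T', hT', rfl⟩
  have hx₀ : 0 ≤ ∑ K, x K := sum_nonneg fun K _ => hx.1 K
  have hkey : ∀ η > 0, sInf A ≤ 2 * ∑ K, C K * x K + η * ∑ K, x K := by
    intro η hη
    obtain ⟨_, ⟨T', hT', rfl⟩, hw⟩ := exists_lt_of_csInf_lt hAne (lt_add_of_pos_right (sInf A) hη)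
    obtain ⟨b, W, hW, hWb, ⟨T₀, hT₀, hWT₀⟩, hex⟩ := hx.exists_exchange hc hT'
    have hterm : ∑ K, x K * b K ≤ ∑ K, (2 * (C K * x K) + η * x K) := by
      refine sum_le_sum fun K _ => ?_
      by_cases hK : x K = 0
      · simp [hK]
      · obtain ⟨D, hD, hwD⟩ := hC K hK
        obtain ⟨T'', hT'', hw''⟩ := hex K hK ∅ D hD
        have := hle T'' (by simpa using hT'')
        have hb : b K ≤ 2 * C K + η := by linarith
        calc x K * b K ≤ x K * (2 * C K + η) := mul_le_mul_of_nonneg_left hb (hx.1 K)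
          _ = _ := by ring
    rw [sum_add_distrib, ← mul_sum, ← mul_sum] at hterm
    linarith [hle T₀ hT₀]
  have hinf : sInf A < 2 * ∑ K, C K * x K + δ := by
    have h := hkey (δ / (∑ K, x K + 1)) (by positivity)
    have : δ / (∑ K, x K + 1) * ∑ K, x K < δ := by
      rw [div_mul_eq_mul_div, div_lt_iff₀ (by positivity)]
      linarith
    linarith
  obtain ⟨_, ⟨T', hT', rfl⟩, hw⟩ := exists_lt_of_csInf_lt hAne hinf
  exact ⟨T', hT', hw.le⟩

/-- The cost bound obtained from `n` rounds of contracting the loss of a random component, each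
component `K` being chosen with probability `ε * x K`. -/
theorem LPFeasible.opt_le_of_rounds (hc : ∀ e, 0 ≤ c e) (hx : LPFeasible E R x) {opt : ℝ}
    (hopt : IsMinCostOf (IsSteinerTree E R) c opt) {C ℓ : Finset V → ℝ}
    (hC : ∀ K, x K ≠ 0 → ∃ X' D, IsLinkSystem E c R K X' D ∧ cost c X' ≤ ℓ K ∧
      weight D + ℓ K ≤ C K)
    {ε : ℝ} (hε : 0 ≤ ε) (hε₁ : ε ≤ 1) (hεx : ε * ∑ K, x K ≤ 1) (n : ℕ) :
    ∀ X T, IsLinkSystem E c R R X T →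
      opt ≤ (∑ K, C K * x K - ∑ K, ℓ K * x K) +
        (1 - ε) ^ n * (weight T - (∑ K, C K * x K - ∑ K, ℓ K * x K)) +
        n * ε * ∑ K, ℓ K * x K + cost c X := by
  set lp := ∑ K, C K * x K
  set lo := ∑ K, ℓ K * x K
  induction n with
  | zero =>
    intro X T hT
    obtain ⟨Y, hYE, hY, hlink⟩ := hT.exists_cost_le hc
    have := le_cost_of_linked hc hopt hYE hlink
    simp only [pow_zero, Nat.cast_zero]
    linarith
  | succ n ih =>
    intro X T hT
    obtain ⟨b, W, hW, hWb, ⟨T₀, hT₀, hWT₀⟩, hex⟩ := hx.exists_exchange hc hT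
    have hα : 0 ≤ (1 - ε) ^ n := pow_nonneg (by linarith) n
    set α := (1 - ε) ^ n with hαdef
    set B := (lp - lo) + α * (W - (lp - lo)) + n * ε * lo + cost c X with hB
    have h₀ : opt ≤ B := by
      have := ih X T₀ hT₀
      have := mul_le_mul_of_nonneg_left hWT₀ hα
      rw [hB]
      linarith
    have hstep : ∑ K, x K * opt ≤
        ∑ K, (x K * B + (α * (C K * x K) - α * (ℓ K * x K) - α * (x K * b K) + ℓ K * x K)) := by
      refine sum_le_sum fun K _ => ?_
      by_cases hK : x K = 0
      · simp [hK]
      · obtain ⟨X', D, hD, hX', hwD⟩ := hC K hK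
        obtain ⟨T', hT', hw'⟩ := hex K hK X' D hD
        have h₁ := ih _ T' hT'
        have h₂ := cost_union_le hc X X'
        have h₃ : weight T' ≤ W - b K + (C K - ℓ K) := by linarith
        have h₄ := mul_le_mul_of_nonneg_left h₃ hα
        have h₅ : opt ≤ B + (α * C K - α * ℓ K - α * b K + ℓ K) := by
          rw [hB]
          linarith
        calc x K * opt ≤ x K * (B + (α * C K - α * ℓ K - α * b K + ℓ K)) :=
              mul_le_mul_of_nonneg_left h₅ (hx.1 K)
          _ = _ := by ring
    simp only [sum_add_distrib, sum_sub_distrib, ← mul_sum, ← sum_mul] at hstep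
    have h₁ := mul_le_mul_of_nonneg_left hstep hε
    have h₂ := mul_le_mul_of_nonneg_left h₀ (sub_nonneg.2 hεx)
    have h₃ := mul_le_mul_of_nonneg_left hWb (mul_nonneg hε hα)
    have h₄ := mul_le_mul_of_nonneg_left hW (mul_nonneg (sub_nonneg.2 hε₁) hα)
    have h₅ : opt ≤ B + ε * (α * lp - α * lo - α * W + lo) := by
      change ε * ((∑ K, x K) * opt) ≤
        ε * ((∑ K, x K) * B + (α * lp - α * lo - α * ∑ K, x K * b K + lo)) at h₁
      linarith
    refine h₅.trans ?_
    rw [hB, pow_succ, ← hαdef]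
    push_cast
    linarith

theorem LPFeasible.opt_le (hc : ∀ e, 0 ≤ c e) (hx : LPFeasible E R x) {opt : ℝ}
    (hopt : IsMinCostOf (IsSteinerTree E R) c opt) {C : Finset V → ℝ}
    (hC : ∀ K, x K ≠ 0 → IsMinCostOf (IsFullComponent E R K) c (C K)) :
    opt ≤ (1 + Real.log 3 / 2) * ∑ K, C K * x K := by
  have hroot : ∀ K, x K ≠ 0 → ∃ r ∈ K, ∃ a ≤ C K, Rooted E c R r K a := by
    intro K hK
    obtain ⟨hKR, hcard, -⟩ := hx.2.1 K hK
    obtain ⟨F, ⟨hFE, -, -, -, hconn, hleaf, -⟩, hFc⟩ := (hC K hK).1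
    obtain ⟨r, hr⟩ : K.Nonempty := card_pos.1 (by omega)
    have hdeg : ∀ v ∈ K, degIn F v ≠ 0 := fun v hv => by
      rw [(hleaf v).2 hv]
      exact one_ne_zero
    obtain ⟨a, ha, hra⟩ := exists_rooted (r := r) hc hFE hKR ⟨r, hr⟩ fun k hk =>
      Linked.reachable_iff.1 (hconn r k (hdeg r hr) (hdeg k hk))
    exact ⟨r, hr, a, hFc ▸ ha, hra⟩
  have hdouble : ∀ K, x K ≠ 0 → ∃ D, IsLinkSystem E c R K ∅ D ∧ weight D ≤ 2 * C K := by
    intro K hK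
    obtain ⟨r, -, a, ha, hra⟩ := hroot K hK
    obtain ⟨D, Q, t, -, -, -, hD, hle⟩ := hra.exists_doubling hc
    exact ⟨D, hD, by linarith [cost_nonneg hc Q]⟩
  have hloss : ∀ K, ∃ ℓ, x K ≠ 0 → ℓ ≤ C K / 2 ∧ ∃ X' D, IsLinkSystem E c R K X' D ∧
      cost c X' ≤ ℓ ∧ weight D + ℓ ≤ C K := by
    intro K
    by_cases hK : x K = 0
    · exact ⟨0, fun h => absurd hK h⟩
    obtain ⟨r, -, a, ha, hra⟩ := hroot K hK
    obtain ⟨X', D, Q, t, d, -, -, -, hD, hd, hle, hX'⟩ := hra.exists_loss hc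
    have hQ := cost_nonneg hc Q
    exact ⟨cost c X', fun _ => ⟨by linarith, X', D, hD, le_rfl, by linarith⟩⟩
  choose ℓ hℓ using hloss
  set lp := ∑ K, C K * x K
  set lo := ∑ K, ℓ K * x K with hlo
  have hlolp : lo ≤ lp / 2 := by
    rw [hlo, sum_div]
    refine sum_le_sum fun K _ => ?_
    by_cases hK : x K = 0
    · simp [hK]
    · have := mul_le_mul_of_nonneg_right (hℓ K hK).1 (hx.1 K)
      linarith
  have hlo₀ : 0 ≤ lo := by
    refine sum_nonneg fun K _ => ?_
    by_cases hK : x K = 0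
    · simp [hK]
    · obtain ⟨-, X', D, -, hX', -⟩ := hℓ K hK
      exact mul_nonneg ((cost_nonneg hc X').trans hX') (hx.1 K)
  obtain ⟨F, ⟨hFE, -, hFconn, -⟩, -⟩ := hopt.1
  have hinit : IsLinkSystem E c R R ∅ ((R ×ˢ R).image fun p => (s(p.1, p.2), cost c F)) := by
    refine ⟨empty_subset _, ?_, ?_, ?_⟩
    · intro l hl v hv
      obtain ⟨⟨p, q⟩, hpq, rfl⟩ := mem_image.1 hl
      rw [mem_product] at hpq
      rw [Sym2.mem_iff] at hv
      obtain rfl | rfl := hv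
      · exact hpq.1
      · exact hpq.2
    · intro l hl
      obtain ⟨⟨p, q⟩, hpq, rfl⟩ := mem_image.1 hl
      rw [mem_product] at hpq
      refine ⟨F, hFE, le_rfl, fun u v huv => ?_⟩
      have hlink := Linked.reachable_iff.1 (hFconn p hpq.1 q hpq.2)
      rw [empty_union]
      obtain ⟨rfl, rfl⟩ | ⟨rfl, rfl⟩ := Sym2.eq_iff.1 huv
      · exact hlink
      · exact hlink.symm
    · intro u hu v hv
      exact Linked.of_mem (mem_image.2 ⟨(u, v), mem_product.2 ⟨hu, hv⟩, rfl⟩) rfl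
  have hlog : 1 < Real.log 3 := by
    rw [Real.lt_log_iff_exp_lt (by norm_num)]
    exact Real.exp_one_lt_d9.trans (by norm_num)
  refine le_of_forall_pos_le_add fun δ hδ => ?_
  obtain ⟨T, hT, hTw⟩ := hx.exists_weight_le hc hinit hdouble hδ
  obtain ⟨N, hN⟩ := exists_nat_ge (Real.log 3 * (∑ K, x K + 1))
  have hx₀ : 0 ≤ ∑ K, x K := sum_nonneg fun K _ => hx.1 K
  have hlog₀ : 0 < Real.log 3 := by linarith
  have hN₀ : (0 : ℝ) < N := lt_of_lt_of_le (by positivity) hN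
  have hNlog : Real.log 3 ≤ N := by nlinarith
  have hround := hx.opt_le_of_rounds hc hopt (fun K hK => (hℓ K hK).2) (ε := Real.log 3 / N)
    (by positivity) ((div_le_one hN₀).2 hNlog)
    (by rw [div_mul_eq_mul_div, div_le_one hN₀]; linarith) N ∅ T hT
  have hpow : (1 - Real.log 3 / N) ^ N ≤ 1 / 3 := by
    refine (Real.one_sub_div_pow_le_exp_neg hNlog).trans (le_of_eq ?_)
    rw [Real.exp_neg, Real.exp_log (by norm_num), one_div]
  have hpow₀ : 0 ≤ (1 - Real.log 3 / N) ^ N :=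
    pow_nonneg (sub_nonneg.2 ((div_le_one hN₀).2 hNlog)) N
  have hcancel : (N : ℝ) * (Real.log 3 / N) = Real.log 3 := by field_simp
  have hempty : cost c ∅ = 0 := sum_empty
  change opt ≤ (lp - lo) + _ * (_ - (lp - lo)) + _ * lo + _ at hround
  change weight T ≤ 2 * lp + δ at hTw
  rw [hcancel, hempty] at hround
  have h₁ : (1 - Real.log 3 / N) ^ N * (weight T - (lp - lo)) ≤ 1 / 3 * (lp + δ + lo) :=
    (mul_le_mul_of_nonneg_left (by linarith) hpow₀).trans
      (mul_le_mul_of_nonneg_right hpow (by linarith))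
  have h₂ := mul_le_mul_of_nonneg_left hlolp (show 0 ≤ Real.log 3 - 2 / 3 by linarith)
  linarith

end Rounding

/-!
STATEMENT 0: the integrality gap of the hypergraphic LP (S) is at most `1 + (ln 3)/2`.
Here `CK K` is the cost of a minimum-cost full component on `K`, `lpstar` is the optimal
value of (S), and `opt` is the minimum cost of a Steiner tree.
-/

theorem hypergraphic_lp_integrality_gap
    (E : Finset (Sym2 V)) (R : Finset V) (c : Sym2 V → ℝ)
    (hc : ∀ e, 0 ≤ c e)
    (htri : ∀ u v w : V, c s(u, w) ≤ c s(u, v) + c s(v, w))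
    (CK : Finset V → ℝ)
    (hCK : ∀ K : Finset V, (∃ F, IsFullComponent E R K F) →
      IsMinCostOf (IsFullComponent E R K) c (CK K))
    (lpstar : ℝ) (hlp : IsLPOpt E R CK lpstar)
    (opt : ℝ) (hopt : IsMinCostOf (IsSteinerTree E R) c opt) :
    opt ≤ (1 + Real.log 3 / 2) * lpstar := by
  obtain ⟨x, hx, rfl⟩ := hlp.1
  exact hx.opt_le hc hopt fun K hK => hCK K (hx.2.1 K hK).2.2
end

section
/- The minimum spanning tree cost of the induced terminal graph satisfies mst(G[R]) ≤ 2 · lp*, where lp* is the optimal value of the hypergraphic LP (S). -/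
/-!
Setting: a finite graph on vertex type `V` is given by its edge set `E : Finset (Sym2 V)`,
with edge costs `c : Sym2 V → ℝ` (nonnegative, satisfying the triangle inequality).
The terminals form a set `R : Finset V`; all other vertices are Steiner vertices.
-/

open Finset

variable {V : Type} [Fintype V] [DecidableEq V]

section Tours

variable {α : Type*}

/-- The sum of `f a b` over all pairs `a, b` of consecutive entries of a list. -/
def stepSum (f : α → α → ℝ) : List α → ℝ
  | [] => 0
  | [_] => 0
  | a :: b :: l => f a b + stepSum f (b :: l)

lemma stepSum_nonneg {f : α → α → ℝ} (hf : ∀ a b, 0 ≤ f a b) :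
    ∀ l : List α, 0 ≤ stepSum f l
  | [] => le_rfl
  | [_] => le_rfl
  | a :: b :: l => add_nonneg (hf a b) (stepSum_nonneg hf (b :: l))

lemma stepSum_cons_le {d : α → α → ℝ} (hd : ∀ a b, 0 ≤ d a b)
    (htri : ∀ a b z, d a z ≤ d a b + d b z) (a b : α) (l : List α) :
    stepSum d (a :: l) ≤ d a b + stepSum d (b :: l) := by
  cases l with
  | nil => simpa [stepSum] using hd a b
  | cons z l =>
    have := htri a b z
    simp only [stepSum]
    linarith

lemma stepSum_cons_filter_le {d : α → α → ℝ} (hd : ∀ a b, 0 ≤ d a b)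
    (htri : ∀ a b z, d a z ≤ d a b + d b z) (p : α → Bool) (l : List α) (a : α) :
    stepSum d (a :: l.filter p) ≤ stepSum d (a :: l) := by
  induction l generalizing a with
  | nil => simp
  | cons b l ih =>
    by_cases hb : p b = true
    · rw [List.filter_cons_of_pos hb]
      simp only [stepSum]
      linarith [ih b]
    · rw [List.filter_cons_of_neg hb]
      exact (ih a).trans (stepSum_cons_le hd htri a b l)

/-- Inserting `v` next to `w` in a tour costs at most twice the distance from `w` to `v`. -/
lemma exists_insert_stepSum_le {d : α → α → ℝ} (hd : ∀ a b, 0 ≤ d a b)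
    (hsymm : ∀ a b, d a b = d b a) (htri : ∀ a b z, d a z ≤ d a b + d b z) (w v : α)
    (l : List α) (a : α) (hw : w ∈ a :: l) :
    ∃ l' : List α, (∀ z, z ∈ a :: l' ↔ z = v ∨ z ∈ a :: l) ∧
      stepSum d (a :: l') ≤ stepSum d (a :: l) + 2 * d w v := by
  induction l generalizing a with
  | nil =>
    obtain rfl : w = a := by simpa using hw
    refine ⟨[v], fun z => ?_, ?_⟩
    · simp only [List.mem_cons, List.not_mem_nil, or_false]
      tauto
    · simp only [stepSum]
      linarith [hd w v]
  | cons b l ih =>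
    rcases List.mem_cons.1 hw with rfl | hw
    · refine ⟨v :: b :: l, fun z => ?_, ?_⟩
      · simp only [List.mem_cons]
        tauto
      · have := htri v w b
        have := hsymm w v
        simp only [stepSum]
        linarith
    · obtain ⟨l', hmem, hle⟩ := ih b hw
      refine ⟨b :: l', fun z => ?_, ?_⟩
      · rw [List.mem_cons, hmem, List.mem_cons (a := z) (b := a)]
        tauto
      · simp only [stepSum]
        linarith

variable [DecidableEq α]

lemma card_image_le_stepSum {β : Type*} [DecidableEq β] (g : α → β) (l : List α) :
    ((l.toFinset.image g).card : ℝ) ≤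
      stepSum (fun a b => if g a ≠ g b then 1 else 0) l + 1 := by
  induction l with
  | nil => simp [stepSum]
  | cons a l ih =>
    cases l with
    | nil => simp [stepSum]
    | cons b l =>
      rw [List.toFinset_cons, Finset.image_insert]
      simp only [stepSum]
      split_ifs with h
      · have : ((insert (g a) ((b :: l).toFinset.image g)).card : ℝ) ≤
            ((b :: l).toFinset.image g).card + 1 := by
          exact_mod_cast Finset.card_insert_le _ _
        linarith
      · rw [Finset.insert_eq_of_mem]
        · linarith
        · rw [not_not] at h
          rw [h]
          exact Finset.mem_image_of_mem g (by simp)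

lemma stepSum_eq_sum (f : α → α → ℝ) (R : Finset α) (l : List α) (hl : ∀ a ∈ l, a ∈ R) :
    stepSum f l = ∑ p ∈ R ×ˢ R,
      f p.1 p.2 * stepSum (fun a b => if (a, b) = p then 1 else 0) l := by
  induction l with
  | nil => simp [stepSum]
  | cons a l ih =>
    cases l with
    | nil => simp [stepSum]
    | cons b l =>
      have hab : (a, b) ∈ R ×ˢ R :=
        Finset.mem_product.2 ⟨hl a (by simp), hl b (by simp)⟩
      simp only [stepSum, mul_add, Finset.sum_add_distrib]
      rw [ih fun z hz => hl z (List.mem_cons_of_mem a hz)]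
      simp [Finset.sum_ite_eq, hab]

end Tours

/-- The vertices reachable from `r` along the edges in `F` can be visited at twice the cost
of `F`. -/
lemma exists_tour {c : Sym2 V → ℝ} (hc : ∀ e, 0 ≤ c e)
    (htri : ∀ u v w : V, c s(u, w) ≤ c s(u, v) + c s(v, w)) (F : Finset (Sym2 V)) (r : V) :
    ∃ l : List V,
      (∀ v, (SimpleGraph.fromEdgeSet (↑F : Set (Sym2 V))).Reachable r v → v ∈ r :: l) ∧
      stepSum (fun a b => c s(a, b)) (r :: l) ≤ 2 * cost c F := by
  set G := SimpleGraph.fromEdgeSet (↑F : Set (Sym2 V))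
  have grow : ∀ n : ℕ, ∀ (l : List V) (A : Finset (Sym2 V)),
      Fintype.card V - (r :: l).toFinset.card = n → A ⊆ F →
      (∀ e ∈ A, ∀ v ∈ e, v ∈ r :: l) →
      stepSum (fun a b => c s(a, b)) (r :: l) ≤ 2 * cost c A →
      ∃ l' : List V, (∀ u ∈ r :: l', ∀ v, G.Adj u v → v ∈ r :: l') ∧
        stepSum (fun a b => c s(a, b)) (r :: l') ≤ 2 * cost c F := by
    intro n
    induction n using Nat.strong_induction_on with
    | _ n ih =>
      intro l A hn hAF hA hle
      by_cases hclosed : ∀ u ∈ r :: l, ∀ v, G.Adj u v → v ∈ r :: l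
      · refine ⟨l, hclosed, hle.trans ?_⟩
        have : cost c A ≤ cost c F :=
          Finset.sum_le_sum_of_subset_of_nonneg hAF fun e _ _ => hc e
        linarith
      · push Not at hclosed
        obtain ⟨u, hu, v, huv, hv⟩ := hclosed
        obtain ⟨l', hmem, hle'⟩ := exists_insert_stepSum_le
          (d := fun a b => c s(a, b)) (fun a b => hc _)
          (fun a b => by rw [Sym2.eq_swap]) (fun a b z => htri a b z) u v l r hu
        have hnot : s(u, v) ∉ A := fun h => hv (hA _ h v (Sym2.mem_mk_right u v))
        have hset : (r :: l').toFinset = insert v (r :: l).toFinset := by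
          ext z
          rw [Finset.mem_insert, List.mem_toFinset, List.mem_toFinset]
          exact hmem z
        have hcard : (r :: l').toFinset.card = (r :: l).toFinset.card + 1 := by
          rw [hset, Finset.card_insert_of_notMem (by rwa [List.mem_toFinset])]
        have hbound := Finset.card_le_univ (r :: l').toFinset
        refine ih _ ?_ l' (insert s(u, v) A) rfl ?_ ?_ ?_
        · omega
        · refine Finset.insert_subset ?_ hAF
          simpa using ((SimpleGraph.fromEdgeSet_adj _).1 huv).1
        · intro e he z hz
          rw [hmem]
          rcases Finset.mem_insert.1 he with rfl | he
          · rcases Sym2.mem_iff.1 hz with rfl | rfl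
            · exact Or.inr hu
            · exact Or.inl rfl
          · exact Or.inr (hA e he z hz)
        · have : cost c (insert s(u, v) A) = c s(u, v) + cost c A := Finset.sum_insert hnot
          rw [this]
          linarith
  obtain ⟨l, hclosed, hle⟩ := grow _ [] ∅ rfl (Finset.empty_subset F) (by simp)
    (by simp [stepSum, cost])
  refine ⟨l, fun v hv => ?_, hle⟩
  obtain ⟨p⟩ := hv
  have mem_of_walk : ∀ {u v : V}, G.Walk u v → u ∈ r :: l → v ∈ r :: l := by
    intro u v p
    induction p with
    | nil => exact id
    | cons h _ ih => exact fun hu => ih (hclosed _ hu _ h)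
  exact mem_of_walk p (by simp)

lemma IsFullComponent.exists_tour {E : Finset (Sym2 V)} {R K : Finset V} {F : Finset (Sym2 V)}
    (hF : IsFullComponent E R K F) {c : Sym2 V → ℝ} (hc : ∀ e, 0 ≤ c e)
    (htri : ∀ u v w : V, c s(u, w) ≤ c s(u, v) + c s(v, w)) :
    ∃ l : List V, l.toFinset = K ∧ stepSum (fun a b => c s(a, b)) l ≤ 2 * cost c F := by
  obtain ⟨-, -, hcard, -, hreach, hleaf, -⟩ := hF
  obtain ⟨r, hr⟩ : K.Nonempty := Finset.card_pos.1 (by omega)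
  obtain ⟨l, hmem, hle⟩ := _root_.exists_tour hc htri F r
  refine ⟨r :: l.filter (· ∈ K), ?_, le_trans ?_ hle⟩
  · ext z
    simp only [List.toFinset_cons, Finset.mem_insert, List.mem_toFinset, List.mem_filter,
      decide_eq_true_eq]
    constructor
    · rintro (rfl | h)
      · exact hr
      · exact h.2
    · intro hz
      have h := hmem z (hreach r z (by simp [(hleaf r).2 hr]) (by simp [(hleaf z).2 hz]))
      rcases List.mem_cons.1 h with h | h
      · exact Or.inl h
      · exact Or.inr ⟨h, hz⟩
  · exact stepSum_cons_filter_le (fun a b => hc _) (fun a b z => htri a b z) _ l r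

/-- Kruskal's algorithm, started from the partition of `R` into the fibres of `g`, is no more
expensive than any fractional edge vector `y` that crosses every partition of `R` at least
(number of parts) - 1 times. -/
lemma exists_connecting_le {α : Type*} [DecidableEq α] (R : Finset α) (d y : α × α → ℝ)
    (hy : ∀ p, 0 ≤ y p)
    (hcross : ∀ g : α → α, ((R.image g).card : ℝ) - 1 ≤
      ∑ p ∈ (R ×ˢ R).filter (fun p => g p.1 ≠ g p.2), y p)
    (k : ℕ) (g : α → α) (hk : (R.image g).card = k + 1) (m : ℝ)
    (hm : ∀ p ∈ (R ×ˢ R).filter (fun p => g p.1 ≠ g p.2), m ≤ d p) :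
    ∃ T ⊆ (R ×ˢ R).filter (fun p => g p.1 ≠ g p.2), T.card = k ∧
      ∑ p ∈ T, (d p - m) ≤
        ∑ p ∈ (R ×ˢ R).filter (fun p => g p.1 ≠ g p.2), (d p - m) * y p ∧
      ∀ G : SimpleGraph α, (∀ p ∈ T, G.Reachable p.1 p.2) →
        (∀ u ∈ R, ∀ v ∈ R, g u = g v → G.Reachable u v) →
        ∀ u ∈ R, ∀ v ∈ R, G.Reachable u v := by
  induction k generalizing g m with
  | zero =>
    refine ⟨∅, Finset.empty_subset _, rfl, ?_, ?_⟩
    · rw [Finset.sum_empty]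
      exact Finset.sum_nonneg fun p hp => mul_nonneg (sub_nonneg.2 (hm p hp)) (hy p)
    · intro G _ hG u hu v hv
      exact hG u hu v hv (Finset.card_le_one.1 hk.le _ (Finset.mem_image_of_mem g hu) _
        (Finset.mem_image_of_mem g hv))
  | succ k ih =>
    have hne : ((R ×ˢ R).filter (fun p => g p.1 ≠ g p.2)).Nonempty := by
      obtain ⟨a, ha, b, hb, hab⟩ := Finset.one_lt_card.1 (by omega : 1 < (R.image g).card)
      obtain ⟨u, hu, rfl⟩ := Finset.mem_image.1 ha
      obtain ⟨v, hv, rfl⟩ := Finset.mem_image.1 hb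
      exact ⟨(u, v), by simp [hu, hv, hab]⟩
    obtain ⟨f, hf, hfmin⟩ := Finset.exists_min_image _ d hne
    obtain ⟨hfR, hfg⟩ := Finset.mem_filter.1 hf
    obtain ⟨hf1, hf2⟩ := Finset.mem_product.1 hfR
    set g' : α → α := fun z => if g z = g f.2 then g f.1 else g z with hg'
    have hsub : (R ×ˢ R).filter (fun p => g' p.1 ≠ g' p.2) ⊆
        (R ×ˢ R).filter (fun p => g p.1 ≠ g p.2) := by
      refine Finset.monotone_filter_right _ fun p _ hp h => hp ?_
      simp only [hg', h]
    have himage : R.image g' = (R.image g).erase (g f.2) := by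
      ext z
      simp only [Finset.mem_image, Finset.mem_erase, hg']
      constructor
      · rintro ⟨a, ha, rfl⟩
        split_ifs with h
        · exact ⟨hfg, f.1, hf1, rfl⟩
        · exact ⟨h, a, ha, rfl⟩
      · rintro ⟨hz, a, ha, rfl⟩
        exact ⟨a, ha, if_neg hz⟩
    have hcard : (R.image g').card = k + 1 := by
      rw [himage, Finset.card_erase_of_mem (Finset.mem_image_of_mem g hf2), hk]
      rfl
    obtain ⟨T, hT, hTcard, hTle, hTconn⟩ := ih g' hcard (d f) fun p hp => hfmin p (hsub hp)
    have hfT : f ∉ T := fun h => by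
      have := (Finset.mem_filter.1 (hT h)).2
      simp [hg'] at this
    refine ⟨insert f T, Finset.insert_subset hf (hT.trans hsub), ?_, ?_, ?_⟩
    · rw [Finset.card_insert_of_notMem hfT, hTcard]
    · have hmono := Finset.sum_le_sum_of_subset_of_nonneg hsub
        (f := fun p => (d p - d f) * y p)
        fun p hp _ => mul_nonneg (sub_nonneg.2 (hfmin p hp)) (hy p)
      have hcut := mul_le_mul_of_nonneg_left (hcross g) (sub_nonneg.2 (hm f hf))
      rw [hk, Finset.mul_sum] at hcut
      have hsplit : ∑ p ∈ (R ×ˢ R).filter (fun p => g p.1 ≠ g p.2), (d p - m) * y p =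
          ∑ p ∈ (R ×ˢ R).filter (fun p => g p.1 ≠ g p.2), (d p - d f) * y p +
          ∑ p ∈ (R ×ˢ R).filter (fun p => g p.1 ≠ g p.2), (d f - m) * y p := by
        rw [← Finset.sum_add_distrib]
        exact Finset.sum_congr rfl fun p _ => by ring
      rw [Finset.sum_insert hfT, hsplit]
      simp only [Finset.sum_sub_distrib, Finset.sum_const, hTcard, nsmul_eq_mul] at hTle ⊢
      push_cast at hcut
      linarith
    · intro G hG hfib
      have hff : G.Reachable f.1 f.2 := hG f (Finset.mem_insert_self f T)
      refine hTconn G (fun p hp => hG p (Finset.mem_insert_of_mem hp)) fun u hu v hv huv => ?_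
      simp only [hg'] at huv
      split_ifs at huv with h1 h2 h2
      · exact hfib u hu v hv (h1.trans h2.symm)
      · exact (hfib u hu _ hf2 h1).trans (hff.symm.trans (hfib _ hf1 v hv huv))
      · exact (hfib u hu _ hf1 huv).trans (hff.trans (hfib _ hf2 v hv h2.symm))
      · exact hfib u hu v hv huv

/-- A feasible solution of the hypergraphic LP satisfies all partition inequalities. -/
lemma LPFeasible.card_image_sub_one_le {E : Finset (Sym2 V)} {R : Finset V} {x : Finset V → ℝ}
    (hx : LPFeasible E R x) (g : V → V) :
    ((R.image g).card : ℝ) - 1 ≤ ∑ K : Finset V, x K * (((K.image g).card : ℝ) - 1) := by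
  obtain ⟨-, hsupp, hsubset, htotal⟩ := hx
  have hparts := Finset.sum_le_sum fun a (ha : a ∈ R.image g) =>
    hsubset (R.filter (g · = a)) (Finset.filter_subset _ R) (by
      obtain ⟨v, hv, rfl⟩ := Finset.mem_image.1 ha
      exact ⟨v, by simp [hv]⟩)
  have hR : ∑ a ∈ R.image g, (((R.filter (g · = a)).card : ℝ) - 1) =
      R.card - (R.image g).card := by
    rw [Finset.card_eq_sum_card_image g R]
    simp
  have hK : ∀ K : Finset V, ∑ a ∈ R.image g,
      (if (K ∩ R.filter (g · = a)).Nonempty then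
        x K * (((K ∩ R.filter (g · = a)).card : ℝ) - 1) else 0) =
      x K * ((K.card : ℝ) - 1) - x K * (((K.image g).card : ℝ) - 1) := by
    intro K
    by_cases hxK : x K = 0
    · simp [hxK]
    have hKR := (hsupp K hxK).1
    have hinter : ∀ a, K ∩ R.filter (g · = a) = K.filter (g · = a) := by
      intro a
      ext v
      simp only [Finset.mem_inter, Finset.mem_filter]
      exact ⟨fun h => ⟨h.1, h.2.2⟩, fun h => ⟨h.1, hKR h.1, h.2⟩⟩
    simp only [hinter]
    rw [← Finset.sum_subset (Finset.image_subset_image hKR)]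
    · have : ∀ a ∈ K.image g, (if (K.filter (g · = a)).Nonempty then
          x K * (((K.filter (g · = a)).card : ℝ) - 1) else 0) =
          x K * (((K.filter (g · = a)).card : ℝ) - 1) := by
        intro a ha
        obtain ⟨v, hv, rfl⟩ := Finset.mem_image.1 ha
        exact if_pos ⟨v, by simp [hv]⟩
      rw [Finset.sum_congr rfl this, ← Finset.mul_sum, Finset.card_eq_sum_card_image g K]
      simp only [Finset.sum_sub_distrib, Finset.sum_const, nsmul_eq_mul, mul_one, Nat.cast_sum]
      ring
    · intro a _ ha
      refine if_neg fun ⟨v, hv⟩ => ha ?_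
      obtain ⟨hvK, rfl⟩ := Finset.mem_filter.1 hv
      exact Finset.mem_image_of_mem g hvK
  rw [hR, Finset.sum_congr rfl fun a _ => Finset.sum_filter _ _, Finset.sum_comm,
    Finset.sum_congr rfl fun K _ => hK K, Finset.sum_sub_distrib, htotal] at hparts
  linarith

/-- A set of pairs of terminals that connects `R` contains a spanning tree of `G[R]`. -/
lemma exists_isSpanningTreeOn {E : Finset (Sym2 V)} {R : Finset V}
    (hRcomplete : ∀ u ∈ R, ∀ v ∈ R, u ≠ v → s(u, v) ∈ E) {c : Sym2 V → ℝ} (hc : ∀ e, 0 ≤ c e)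
    (T : Finset (V × V)) (hT : ∀ p ∈ T, p.1 ∈ R ∧ p.2 ∈ R ∧ p.1 ≠ p.2)
    (hconn : ∀ G : SimpleGraph V, (∀ p ∈ T, G.Reachable p.1 p.2) →
      ∀ u ∈ R, ∀ v ∈ R, G.Reachable u v) :
    ∃ F, IsSpanningTreeOn E R F ∧ cost c F ≤ ∑ p ∈ T, c s(p.1, p.2) := by
  classical
  set D : Finset (Sym2 V) := T.image fun p => s(p.1, p.2) with hD
  obtain ⟨G, hGD, hG, hreach⟩ :=
    (SimpleGraph.fromEdgeSet (↑D : Set (Sym2 V))).exists_isAcyclic_reachable_eq_le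
  have hGe : SimpleGraph.fromEdgeSet (↑G.edgeFinset : Set (Sym2 V)) = G := by simp
  have hsub : G.edgeFinset ⊆ D := by
    intro e he
    have := SimpleGraph.edgeSet_mono hGD (SimpleGraph.mem_edgeFinset.1 he)
    rw [SimpleGraph.edgeSet_fromEdgeSet] at this
    exact this.1
  refine ⟨G.edgeFinset, ⟨?_, ?_, ?_, ?_⟩, ?_⟩
  · intro e he
    obtain ⟨p, hp, rfl⟩ := Finset.mem_image.1 (hsub he)
    exact hRcomplete _ (hT p hp).1 _ (hT p hp).2.1 (hT p hp).2.2
  · intro e he v hv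
    obtain ⟨p, hp, rfl⟩ := Finset.mem_image.1 (hsub he)
    rcases Sym2.mem_iff.1 hv with rfl | rfl
    · exact (hT p hp).1
    · exact (hT p hp).2.1
  · rwa [hGe]
  · rw [hGe]
    refine hconn G fun p hp => ?_
    rw [hreach]
    refine SimpleGraph.Adj.reachable ?_
    rw [SimpleGraph.fromEdgeSet_adj]
    exact ⟨Finset.mem_coe.2 (Finset.mem_image_of_mem _ hp), (hT p hp).2.2⟩
  · exact (Finset.sum_le_sum_of_subset_of_nonneg hsub fun e _ _ => hc e).trans
      (Finset.sum_image_le_of_nonneg fun e _ => hc e)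

/-!
STATEMENT 2: `mst(G[R]) ≤ 2·lp*`. The costs satisfy the triangle inequality; by the
standing "metric closure" assumption this means in particular that all terminal-terminal
pairs are edges of `G` (hypothesis `hRcomplete`), so that `G[R]` is the complete graph
on the terminals.
-/

theorem mst_le_two_lpstar
    (E : Finset (Sym2 V)) (R : Finset V) (c : Sym2 V → ℝ)
    (hc : ∀ e, 0 ≤ c e)
    (htri : ∀ u v w : V, c s(u, w) ≤ c s(u, v) + c s(v, w))
    (hRcomplete : ∀ u ∈ R, ∀ v ∈ R, u ≠ v → s(u, v) ∈ E)
    (CK : Finset V → ℝ)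
    (hCK : ∀ K : Finset V, (∃ F, IsFullComponent E R K F) →
      IsMinCostOf (IsFullComponent E R K) c (CK K))
    (lpstar : ℝ) (hlp : IsLPOpt E R CK lpstar)
    (mstR : ℝ) (hmst : IsMinCostOf (IsSpanningTreeOn E R) c mstR) :
    mstR ≤ 2 * lpstar := by
  classical
  obtain ⟨⟨x, hx, rfl⟩, -⟩ := hlp
  obtain ⟨hx0, hsupp, -, htotal⟩ := id hx
  have htour : ∀ K : Finset V, ∃ l : List V, x K ≠ 0 →
      l.toFinset = K ∧ stepSum (fun a b => c s(a, b)) l ≤ 2 * CK K := by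
    intro K
    by_cases hK : x K = 0
    · exact ⟨[], fun h => absurd hK h⟩
    · obtain ⟨⟨F, hF, hcost⟩, -⟩ := hCK K (hsupp K hK).2.2
      obtain ⟨l, hl⟩ := hF.exists_tour hc htri
      exact ⟨l, fun _ => hcost ▸ hl⟩
  choose L hL using htour
  have hLR : ∀ K, x K ≠ 0 → ∀ a ∈ L K, a ∈ R := fun K hK a ha =>
    (hsupp K hK).1 (by rw [← (hL K hK).1]; exact List.mem_toFinset.2 ha)
  set y : V × V → ℝ := fun p =>
    ∑ K : Finset V, x K * stepSum (fun a b => if (a, b) = p then 1 else 0) (L K) with hy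
  have hy0 : ∀ p, 0 ≤ y p := fun p => Finset.sum_nonneg fun K _ =>
    mul_nonneg (hx0 K) (stepSum_nonneg (fun a b => by split_ifs <;> norm_num) _)
  have hsum : ∀ f : V → V → ℝ, ∑ p ∈ R ×ˢ R, f p.1 p.2 * y p =
      ∑ K : Finset V, x K * stepSum f (L K) := by
    intro f
    simp only [hy, Finset.mul_sum]
    rw [Finset.sum_comm]
    refine Finset.sum_congr rfl fun K _ => ?_
    by_cases hK : x K = 0
    · simp [hK]
    rw [stepSum_eq_sum f R (L K) (hLR K hK), Finset.mul_sum]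
    exact Finset.sum_congr rfl fun p _ => by ring
  have hcross : ∀ g : V → V, ((R.image g).card : ℝ) - 1 ≤
      ∑ p ∈ (R ×ˢ R).filter (fun p => g p.1 ≠ g p.2), y p := by
    intro g
    have h := hsum fun a b => if g a ≠ g b then 1 else 0
    simp only [ite_mul, one_mul, zero_mul] at h
    rw [Finset.sum_filter, h]
    refine (hx.card_image_sub_one_le g).trans (Finset.sum_le_sum fun K _ => ?_)
    by_cases hK : x K = 0
    · simp [hK]
    have := card_image_le_stepSum g (L K)
    rw [(hL K hK).1] at this
    exact mul_le_mul_of_nonneg_left (by linarith) (hx0 K)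
  have hR : 0 < R.card := by
    have : 0 ≤ ∑ K : Finset V, x K * ((K.card : ℝ) - 1) := Finset.sum_nonneg fun K _ => by
      by_cases hK : x K = 0
      · simp [hK]
      have : (2 : ℝ) ≤ K.card := by exact_mod_cast (hsupp K hK).2.1
      exact mul_nonneg (hx0 K) (by linarith)
    have : (0 : ℝ) < R.card := by linarith
    exact_mod_cast this
  obtain ⟨T, hT, -, hTle, hTconn⟩ := exists_connecting_le R (fun p => c s(p.1, p.2)) y hy0
    hcross (R.card - 1) id (by rw [Finset.image_id]; omega) 0 fun p _ => hc _
  obtain ⟨F, hF, hFle⟩ := exists_isSpanningTreeOn hRcomplete hc T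
    (fun p hp => by simpa [and_assoc] using hT hp)
    fun G hG => hTconn G hG fun u _ v _ huv => by
      obtain rfl : u = v := huv
      exact SimpleGraph.Reachable.refl u
  simp only [sub_zero] at hTle
  calc mstR ≤ cost c F := hmst.2 F hF
    _ ≤ ∑ p ∈ T, c s(p.1, p.2) := hFle
    _ ≤ ∑ p ∈ (R ×ˢ R).filter (fun p => id p.1 ≠ id p.2), c s(p.1, p.2) * y p := hTle
    _ ≤ ∑ p ∈ R ×ˢ R, c s(p.1, p.2) * y p :=
      Finset.sum_le_sum_of_subset_of_nonneg (Finset.filter_subset _ _)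
        fun p _ _ => mul_nonneg (hc _) (hy0 p)
    _ = ∑ K : Finset V, x K * stepSum (fun a b => c s(a, b)) (L K) :=
      hsum fun a b => c s(a, b)
    _ ≤ ∑ K : Finset V, 2 * (CK K * x K) := Finset.sum_le_sum fun K _ => by
      by_cases hK : x K = 0
      · simp [hK]
      have := mul_le_mul_of_nonneg_left (hL K hK).2 (hx0 K)
      linarith
    _ = 2 * lpValue CK x := by rw [lpValue, Finset.mul_sum]
end

section
/- In a quasi-bipartite instance (G has no edge between two Steiner vertices), for every feasible solution x of the hypergraphic LP (S), the minimum spanning tree cost of the terminal graph satisfies mst(G[R]) ≤ 2·∑_K x_K·(C_K − loss(K)); in particular mst(G[R]) ≤ 2·(lp* − loss*) for an optimal solution x. -/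
/-!
Setting: a finite graph on vertex type `V` is given by its edge set `E : Finset (Sym2 V)`,
with edge costs `c : Sym2 V → ℝ` (nonnegative, satisfying the triangle inequality).
The terminals form a set `R : Finset V`; all other vertices are Steiner vertices.
-/

open Finset

variable {V : Type} [Fintype V] [DecidableEq V]

/-- `L` is a loss set of the full component `F`: a set of edges of `F` connecting every
Steiner vertex of `F` to some terminal. -/
def IsLossSet (R : Finset V) (F L : Finset (Sym2 V)) : Prop :=
  L ⊆ F ∧
  ∀ v : V, v ∉ R → degIn F v ≠ 0 →
    ∃ r ∈ R, (SimpleGraph.fromEdgeSet (↑L : Set (Sym2 V))).Reachable v r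

/-- `L = Loss(K)`: a minimum-cost loss set of the full component `F` (taken inclusionwise
minimal, which holds without loss of generality since costs are nonnegative). -/
def IsMinLoss (c : Sym2 V → ℝ) (R : Finset V) (F L : Finset (Sym2 V)) : Prop :=
  IsLossSet R F L ∧ (∀ L', IsLossSet R F L' → cost c L ≤ cost c L') ∧
  ∀ L' ⊆ L, IsLossSet R F L' → L' = L

/-- A nonnegative fractional edge set crossing every partition `f` of `R` with total weight at
least `|f(R)| - 1` dominates the cost of some edge set which connects the classes of `f`. -/
theorem exists_connecting_edges {V ι : Type} [Fintype ι] [DecidableEq V] (R : Finset V)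
    (p q : ι → V) (z : ι → ℝ) (hz : ∀ i, 0 ≤ z i) (hpq : ∀ i, z i ≠ 0 → p i ∈ R ∧ q i ∈ R)
    (hcut : ∀ f : V → V,
      ((R.image f).card : ℝ) - 1 ≤ ∑ i, if f (p i) ≠ f (q i) then z i else 0)
    (n : ℕ) (f : V → V) (hn : (R.image f).card ≤ n + 1) (w : Sym2 V → ℝ)
    (hw : ∀ u ∈ R, ∀ v ∈ R, f u ≠ f v → 0 ≤ w s(u, v)) :
    ∃ T : Finset (Sym2 V), (∀ e ∈ T, ¬ e.IsDiag ∧ ∀ v ∈ e, v ∈ R) ∧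
      T.card ≤ (R.image f).card - 1 ∧
      ∑ e ∈ T, w e ≤ ∑ i, (if f (p i) ≠ f (q i) then z i * w s(p i, q i) else 0) ∧
      ∀ r : V → V → Prop, Equivalence r → (∀ u v, s(u, v) ∈ T → r u v) →
        (∀ u ∈ R, ∀ v ∈ R, f u = f v → r u v) → ∀ u ∈ R, ∀ v ∈ R, r u v := by
  have hterm : ∀ (f : V → V) (w : Sym2 V → ℝ),
      (∀ u ∈ R, ∀ v ∈ R, f u ≠ f v → 0 ≤ w s(u, v)) → ∀ i,
      0 ≤ (if f (p i) ≠ f (q i) then z i * w s(p i, q i) else 0) := by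
    intro f w hw i
    split_ifs with h
    · by_cases h0 : z i = 0
      · simp [h0]
      · exact mul_nonneg (hz i) (hw _ (hpq i h0).1 _ (hpq i h0).2 h)
    · exact le_rfl
  induction n generalizing f w with
  | zero =>
    refine ⟨∅, by simp, by simp, ?_, fun r _ _ hr u hu v hv => hr u hu v hv ?_⟩
    · simpa using Finset.sum_nonneg fun i _ => hterm f w hw i
    · exact Finset.card_le_one.1 hn _ (mem_image_of_mem f hu) _ (mem_image_of_mem f hv)
  | succ n ih =>
    by_cases hle : (R.image f).card ≤ n + 1
    · exact ih f hle w hw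
    have hne : ((R ×ˢ R).filter fun a => f a.1 ≠ f a.2).Nonempty := by
      obtain ⟨a, ha, b, hb, hab⟩ := Finset.one_lt_card.1 (by omega : 1 < (R.image f).card)
      obtain ⟨u, hu, rfl⟩ := mem_image.1 ha
      obtain ⟨v, hv, rfl⟩ := mem_image.1 hb
      exact ⟨(u, v), by simp [hu, hv, hab]⟩
    obtain ⟨⟨u₀, v₀⟩, h₀, hmin⟩ := exists_min_image _ (fun a => w s(a.1, a.2)) hne
    simp only [mem_filter, mem_product, and_imp, Prod.forall] at h₀ hmin
    obtain ⟨⟨hu₀, hv₀⟩, huv⟩ := h₀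
    set m := w s(u₀, v₀)
    set g : V → V := fun a => if f a = f v₀ then f u₀ else f a with hg
    have hgf : ∀ a b, f a = f b → g a = g b := fun a b h => by simp [hg, h]
    have himg : R.image g ⊆ (R.image f).erase (f v₀) := by
      intro y hy
      obtain ⟨a, ha, rfl⟩ := mem_image.1 hy
      by_cases h : f a = f v₀
      · simp only [hg, h, if_true]
        exact mem_erase.2 ⟨huv, mem_image_of_mem f hu₀⟩
      · simp only [hg, h, if_false]
        exact mem_erase.2 ⟨h, mem_image_of_mem f ha⟩
    have hcard := card_le_card himg
    rw [card_erase_of_mem (mem_image_of_mem f hv₀)] at hcard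
    obtain ⟨T, hTR, hTc, hTw, hTr⟩ := ih g (by omega) (fun e => w e - m) (by
      intro u hu v hv h
      have := hmin u v hu hv fun h' => h (hgf _ _ h')
      linarith)
    refine ⟨insert s(u₀, v₀) T, ?_, ?_, ?_, ?_⟩
    · intro e he
      rcases mem_insert.1 he with rfl | he
      · refine ⟨fun h => huv (by rw [Sym2.mk_isDiag_iff.1 h]), ?_⟩
        intro v hv
        rcases Sym2.mem_iff.1 hv with rfl | rfl <;> assumption
      · exact hTR e he
    · have := card_insert_le s(u₀, v₀) T
      omega
    · have hm0 : 0 ≤ m := hw _ hu₀ _ hv₀ huv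
      have hc1 : (insert s(u₀, v₀) T).card + 1 ≤ (R.image f).card := by
        have := card_insert_le s(u₀, v₀) T
        omega
      have hc2 : ((insert s(u₀, v₀) T).card : ℝ) ≤ ((R.image f).card : ℝ) - 1 := by
        have : ((insert s(u₀, v₀) T).card : ℝ) + 1 ≤ (R.image f).card := by exact_mod_cast hc1
        linarith
      have hsplit : ∑ e ∈ insert s(u₀, v₀) T, w e =
          ∑ e ∈ T, (w e - m) + (insert s(u₀, v₀) T).card * m := by
        rw [← sum_insert_of_eq_zero_if_notMem (a := s(u₀, v₀)) (f := fun e => w e - m)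
          (fun _ => sub_self _), sum_sub_distrib]
        simp
      have hmono : (∑ i, if g (p i) ≠ g (q i) then z i * (w s(p i, q i) - m) else 0) ≤
          ∑ i, if f (p i) ≠ f (q i) then z i * (w s(p i, q i) - m) else 0 := by
        refine sum_le_sum fun i _ => ?_
        by_cases h : f (p i) = f (q i)
        · simp [h, hgf _ _ h]
        · have := hterm f (fun e => w e - m) (fun u hu v hv h => by
            have := hmin u v hu hv h
            linarith) i
          by_cases h' : g (p i) = g (q i)
          · simpa [h'] using this
          · simp [h, h']
      have hexp : (∑ i, if f (p i) ≠ f (q i) then z i * (w s(p i, q i) - m) else 0) =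
          (∑ i, if f (p i) ≠ f (q i) then z i * w s(p i, q i) else 0) -
            (∑ i, if f (p i) ≠ f (q i) then z i else 0) * m := by
        rw [sum_mul, ← sum_sub_distrib]
        refine sum_congr rfl fun i _ => ?_
        split_ifs <;> ring
      have := mul_le_mul_of_nonneg_right (hc2.trans (hcut f)) hm0
      linarith
    · intro r hr hT hf
      refine hTr r hr (fun u v h => hT u v (mem_insert_of_mem h)) ?_
      have h₀ : r u₀ v₀ := hT _ _ (mem_insert_self _ _)
      intro u hu v hv h
      simp only [hg] at h
      split_ifs at h with h1 h2 h2
      · exact hf u hu v hv (h1.trans h2.symm)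
      · exact hr.trans (hf u hu v₀ hv₀ h1) (hr.trans (hr.symm h₀) (hf u₀ hu₀ v hv h))
      · exact hr.trans (hf u hu u₀ hu₀ h) (hr.trans h₀ (hf v₀ hv₀ v hv h2.symm))
      · exact hf u hu v hv h

/-- Feasible solutions of (S) satisfy the partition inequalities. -/
theorem LPFeasible.partition_le {V : Type} [Fintype V] [DecidableEq V] {E : Finset (Sym2 V)}
    {R : Finset V} {x : Finset V → ℝ} (hx : LPFeasible E R x) (f : V → V) :
    ((R.image f).card : ℝ) - 1 ≤ ∑ K : Finset V, x K * (((K.image f).card : ℝ) - 1) := by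
  obtain ⟨-, hsupp, hS, htot⟩ := hx
  set S : V → Finset V := fun y => R.filter fun a => f a = y with hSdef
  have hcard : ∀ K ⊆ R, (K.card : ℝ) = ∑ y ∈ R.image f, ((K ∩ S y).card : ℝ) := by
    intro K hK
    rw [Finset.card_eq_sum_card_fiberwise (f := f) (t := R.image f)
      fun a ha => Finset.mem_coe.2 (Finset.mem_image_of_mem f (hK ha))]
    push_cast
    refine Finset.sum_congr rfl fun y _ => ?_
    congr 2
    ext a
    simp only [hSdef, Finset.mem_filter, Finset.mem_inter]
    exact ⟨fun h => ⟨h.1, hK h.1, h.2⟩, fun h => ⟨h.1, h.2.2⟩⟩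
  have himg : ∀ K ⊆ R, ((K.image f).card : ℝ) =
      ∑ y ∈ R.image f, if (K ∩ S y).Nonempty then (1 : ℝ) else 0 := by
    intro K hK
    rw [Finset.sum_boole]
    congr 2
    ext y
    simp only [hSdef, Finset.mem_filter, Finset.mem_image, Finset.Nonempty, Finset.mem_inter]
    constructor
    · rintro ⟨a, ha, rfl⟩
      exact ⟨⟨a, hK ha, rfl⟩, a, ha, hK ha, rfl⟩
    · rintro ⟨-, a, ha, -, rfl⟩
      exact ⟨a, ha, rfl⟩
  have hdiff : ∀ K : Finset V, x K * ((K.card : ℝ) - (K.image f).card) =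
      ∑ y ∈ R.image f, if (K ∩ S y).Nonempty then x K * (((K ∩ S y).card : ℝ) - 1) else 0 := by
    intro K
    by_cases h0 : x K = 0
    · simp [h0]
    have hK := (hsupp K h0).1
    rw [hcard K hK, himg K hK, ← Finset.sum_sub_distrib, Finset.mul_sum]
    refine Finset.sum_congr rfl fun y _ => ?_
    split_ifs with h
    · rfl
    · simp [Finset.not_nonempty_iff_eq_empty.1 h]
  have hle : ∑ K : Finset V, x K * ((K.card : ℝ) - (K.image f).card) ≤
      (R.card : ℝ) - (R.image f).card := by
    have hRcard : (R.card : ℝ) = ∑ y ∈ R.image f, ((S y).card : ℝ) := by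
      exact_mod_cast Finset.card_eq_sum_card_image f R
    rw [Finset.sum_congr rfl fun K _ => hdiff K, Finset.sum_comm, hRcard,
      Finset.cast_card (R.image f), ← Finset.sum_sub_distrib]
    refine Finset.sum_le_sum fun y hy => ?_
    rw [← Finset.sum_filter]
    obtain ⟨a, ha, rfl⟩ := Finset.mem_image.1 hy
    exact hS _ (Finset.filter_subset _ _) ⟨a, by simp [hSdef, ha]⟩
  have hsplit : ∑ K : Finset V, x K * (((K.image f).card : ℝ) - 1) =
      ∑ K : Finset V, x K * ((K.card : ℝ) - 1) -
        ∑ K : Finset V, x K * ((K.card : ℝ) - (K.image f).card) := by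
    rw [← Finset.sum_sub_distrib]
    exact Finset.sum_congr rfl fun K _ => by ring
  linarith

/-- If all neighbours of `y` are leaves, the connected component of `y` is a star. -/
theorem eq_or_adj_of_reachable_of_degIn_eq_one {V : Type} [DecidableEq V]
    {F : Finset (Sym2 V)} {y : V}
    (hy : ∀ u, (SimpleGraph.fromEdgeSet (↑F : Set (Sym2 V))).Adj y u → degIn F u = 1) {v : V}
    (hv : (SimpleGraph.fromEdgeSet (↑F : Set (Sym2 V))).Reachable y v) :
    v = y ∨ (SimpleGraph.fromEdgeSet (↑F : Set (Sym2 V))).Adj y v := by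
  rw [SimpleGraph.reachable_iff_reflTransGen] at hv
  induction hv with
  | refl => exact Or.inl rfl
  | @tail b d _ hbd ih =>
    rcases ih with rfl | hyb
    · exact Or.inr hbd
    · obtain ⟨e, he⟩ := Finset.card_eq_one.1 (hy b hyb)
      have h1 : s(y, b) ∈ F.filter fun e => b ∈ e := by
        simpa using ((SimpleGraph.fromEdgeSet_adj _).1 hyb).1
      have h2 : s(b, d) ∈ F.filter fun e => b ∈ e := by
        simpa using ((SimpleGraph.fromEdgeSet_adj _).1 hbd).1
      rw [he, Finset.mem_singleton] at h1 h2
      rw [← h2, Sym2.eq_swap] at h1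
      exact Or.inl (Sym2.congr_right.1 h1).symm

/-- A vertex incident to an edge of `F` has nonzero degree in `F`. -/
theorem degIn_ne_zero {V : Type} [DecidableEq V] {F : Finset (Sym2 V)} {e : Sym2 V} {v : V}
    (he : e ∈ F) (hv : v ∈ e) : degIn F v ≠ 0 :=
  Finset.card_ne_zero_of_mem (Finset.mem_filter.2 ⟨he, hv⟩)

/-- The edges of `F` joining `y` to a set `K` cost at most `F`. -/
theorem sum_star_le_cost {V : Type} [DecidableEq V] {c : Sym2 V → ℝ} (hc : ∀ e, 0 ≤ c e)
    {F : Finset (Sym2 V)} {y : V} {K : Finset V} (hK : ∀ k ∈ K, s(y, k) ∈ F) :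
    ∑ k ∈ K, c s(y, k) ≤ cost c F := by
  rw [← Finset.sum_image (s := K) (g := fun k => s(y, k)) fun a _ b _ h => Sym2.congr_right.1 h]
  exact Finset.sum_le_sum_of_subset_of_nonneg
    (Finset.image_subset_iff.2 hK) fun e _ _ => hc e

/-- In a quasi-bipartite instance the terminals of a full component are spanned by a star,
centred at a terminal, of cost at most twice the cost of the component minus its loss. -/
theorem IsFullComponent.exists_star_le {V : Type} [DecidableEq V]
    {E : Finset (Sym2 V)} {R K : Finset V} {c : Sym2 V → ℝ}
    (hc : ∀ e, 0 ≤ c e) (htri : ∀ u v w : V, c s(u, w) ≤ c s(u, v) + c s(v, w))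
    (hqb : ∀ e ∈ E, ∃ v, v ∈ e ∧ v ∈ R) {F : Finset (Sym2 V)} (hF : IsFullComponent E R K F)
    {l : ℝ} (hl : ∀ L, IsLossSet R F L → l ≤ cost c L) :
    ∃ a ∈ K, ∑ k ∈ K.erase a, c s(a, k) ≤ 2 * (cost c F - l) := by
  obtain ⟨hFE, hKR, hK2, -, hconn, hleaf, hint⟩ := hF
  have hKne : K.Nonempty := Finset.card_pos.1 (by omega)
  have hterm : ∀ v ∈ R, degIn F v ≠ 0 → degIn F v = 1 := by
    intro v hv h
    by_contra h1
    exact hint v (by omega) hv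
  have hdeg : ∀ k ∈ K, degIn F k ≠ 0 := fun k hk => by simp [(hleaf k).2 hk]
  by_cases hs : ∃ s, s ∉ R ∧ degIn F s ≠ 0
  · obtain ⟨s, hsR, hsd⟩ := hs
    have hN : ∀ u, (SimpleGraph.fromEdgeSet (↑F : Set (Sym2 V))).Adj s u → u ∈ R := by
      intro u hu
      obtain ⟨v, hv, hvR⟩ := hqb _ (hFE ((SimpleGraph.fromEdgeSet_adj _).1 hu).1)
      rcases Sym2.mem_iff.1 hv with rfl | rfl
      · exact absurd hvR hsR
      · exact hvR
    have hstar : ∀ v, degIn F v ≠ 0 →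
        v = s ∨ (SimpleGraph.fromEdgeSet (↑F : Set (Sym2 V))).Adj s v := by
      refine fun v hv => eq_or_adj_of_reachable_of_degIn_eq_one (fun u hu => ?_)
        (hconn s v hsd hv)
      exact hterm u (hN u hu)
        (degIn_ne_zero ((SimpleGraph.fromEdgeSet_adj _).1 hu).1 (Sym2.mem_mk_right _ _))
    have hadj : ∀ k ∈ K, (SimpleGraph.fromEdgeSet (↑F : Set (Sym2 V))).Adj s k := by
      intro k hk
      exact (hstar k (hdeg k hk)).resolve_left fun h => hsR (h ▸ hKR hk)
    have hmem : ∀ k ∈ K, s(s, k) ∈ F := fun k hk =>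
      ((SimpleGraph.fromEdgeSet_adj _).1 (hadj k hk)).1
    obtain ⟨a, ha, hmin⟩ := Finset.exists_min_image K (fun k => c s(s, k)) hKne
    refine ⟨a, ha, ?_⟩
    have hloss : l ≤ c s(s, a) := by
      have := hl {s(s, a)} ⟨by simpa using hmem a ha, fun v hv hvd => ⟨a, hKR ha, ?_⟩⟩
      · simpa [cost] using this
      · obtain rfl : v = s := (hstar v hvd).resolve_right fun h => hv (hN v h)
        exact SimpleGraph.Adj.reachable
          ((SimpleGraph.fromEdgeSet_adj _).2 ⟨by simp, (hadj a ha).ne⟩)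
    have hsum := sum_star_le_cost hc hmem
    rw [← Finset.add_sum_erase K _ ha] at hsum
    have hdouble : ∑ k ∈ K.erase a, c s(a, k) ≤ ∑ k ∈ K.erase a, 2 * c s(s, k) := by
      refine Finset.sum_le_sum fun k hk => ?_
      have h1 := htri a s k
      have h2 := hmin k (Finset.mem_of_mem_erase hk)
      rw [Sym2.eq_swap (a := a) (b := s)] at h1
      linarith
    rw [← Finset.mul_sum] at hdouble
    linarith
  · push Not at hs
    have hR : ∀ v, degIn F v ≠ 0 → v ∈ R := fun v hv => by
      by_contra h
      exact hv (hs v h)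
    obtain ⟨a, ha⟩ := hKne
    refine ⟨a, ha, ?_⟩
    have hloss : l ≤ 0 := by
      simpa [cost] using hl ∅ ⟨by simp, fun v hv hvd => absurd (hR v hvd) hv⟩
    have hmem : ∀ k ∈ K.erase a, s(a, k) ∈ F := by
      intro k hk
      refine ((SimpleGraph.fromEdgeSet_adj _).1
        ((eq_or_adj_of_reachable_of_degIn_eq_one (fun u hu => ?_)
          (hconn a k (hdeg a ha) (hdeg k (Finset.mem_of_mem_erase hk)))).resolve_left
            (Finset.ne_of_mem_erase hk))).1
      have := degIn_ne_zero ((SimpleGraph.fromEdgeSet_adj _).1 hu).1 (Sym2.mem_mk_right a u)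
      exact hterm u (hR u this) this
    have hsum := sum_star_le_cost hc hmem
    have : 0 ≤ cost c F := Finset.sum_nonneg fun e _ => hc e
    linarith

/-- An edge set connecting the terminals contains a spanning tree. -/
theorem exists_isSpanningTreeOn_subset {V : Type} [DecidableEq V]
    {E T : Finset (Sym2 V)} {R : Finset V} (hTE : T ⊆ E) (hTR : ∀ e ∈ T, ∀ v ∈ e, v ∈ R)
    (hconn : ∀ u ∈ R, ∀ v ∈ R, (SimpleGraph.fromEdgeSet (↑T : Set (Sym2 V))).Reachable u v) :
    ∃ T' ⊆ T, IsSpanningTreeOn E R T' := by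
  classical
  obtain ⟨H, -, hHT, hH, hreach⟩ :=
    SimpleGraph.exists_isAcyclic_reachable_eq_le_of_le_of_isAcyclic
      (bot_le : ⊥ ≤ SimpleGraph.fromEdgeSet (↑T : Set (Sym2 V))) SimpleGraph.isAcyclic_bot
  have hsub : T.filter (· ∈ H.edgeSet) ⊆ T := Finset.filter_subset _ _
  have heq : SimpleGraph.fromEdgeSet (↑(T.filter (· ∈ H.edgeSet)) : Set (Sym2 V)) = H := by
    ext u v
    simp only [SimpleGraph.fromEdgeSet_adj, Finset.coe_filter, Set.mem_ofPred_eq,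
      SimpleGraph.mem_edgeSet]
    exact ⟨fun h => h.1.2, fun h => ⟨⟨((SimpleGraph.fromEdgeSet_adj _).1 (hHT h)).1, h⟩, h.ne⟩⟩
  refine ⟨_, hsub, hsub.trans hTE, fun e he => hTR e (hsub he), ?_, fun u hu v hv => ?_⟩
  · rwa [heq]
  · rw [heq, hreach]
    exact hconn u hu v hv

/-!
STATEMENT 9: in a quasi-bipartite instance (no Steiner–Steiner edges), for every feasible
solution `x` of the hypergraphic LP (S), `mst(G[R]) ≤ 2·∑_K x_K (C_K − loss(K))`.
Here `CK K` is the cost of a minimum-cost full component `F(K)` and `lossK K` the cost of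
a minimum-cost loss set of `F(K)`. The costs satisfy the triangle inequality; by the
standing "metric closure" assumption all terminal-terminal pairs are edges of `G`.
(Applied to an optimal `x`, this gives `mst(G[R]) ≤ 2(lp* − loss*)`.)
-/

theorem quasi_bipartite_mst_bound
    (E : Finset (Sym2 V)) (R : Finset V) (c : Sym2 V → ℝ)
    (hc : ∀ e, 0 ≤ c e)
    (htri : ∀ u v w : V, c s(u, w) ≤ c s(u, v) + c s(v, w))
    (hqb : ∀ e ∈ E, ∃ v, v ∈ e ∧ v ∈ R)
    (hRcomplete : ∀ u ∈ R, ∀ v ∈ R, u ≠ v → s(u, v) ∈ E)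
    (x : Finset V → ℝ) (hx : LPFeasible E R x)
    (CK lossK : Finset V → ℝ)
    (hCL : ∀ K : Finset V, x K ≠ 0 →
      ∃ F, IsFullComponent E R K F ∧ cost c F = CK K ∧
        (∀ F', IsFullComponent E R K F' → CK K ≤ cost c F') ∧
        ∃ L, IsLossSet R F L ∧ cost c L = lossK K ∧
          ∀ L', IsLossSet R F L' → lossK K ≤ cost c L')
    (mstR : ℝ) (hmst : IsMinCostOf (IsSpanningTreeOn E R) c mstR) :
    mstR ≤ 2 * ∑ K : Finset V, x K * (CK K - lossK K) := by
  obtain ⟨v₀⟩ : Nonempty V := by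
    by_contra hV
    rw [not_nonempty_iff] at hV
    have htot := hx.2.2.2
    simp [Finset.eq_empty_of_isEmpty] at htot
    have h := (hx.2.1 ∅ (by simp [htot])).2.1
    simp at h
  have hstar : ∀ K : Finset V, ∃ a, x K ≠ 0 →
      a ∈ K ∧ ∑ k ∈ K.erase a, c s(a, k) ≤ 2 * (CK K - lossK K) := by
    intro K
    by_cases h0 : x K = 0
    · exact ⟨v₀, fun h => absurd h0 h⟩
    · obtain ⟨F, hF, hFc, -, L, -, -, hL⟩ := hCL K h0
      obtain ⟨a, ha, hsum⟩ := hF.exists_star_le hc htri hqb hL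
      exact ⟨a, fun _ => ⟨ha, hFc ▸ hsum⟩⟩
  choose a ha using hstar
  have hx0 := hx.1
  obtain ⟨T, hTR, -, hTw, hTr⟩ := exists_connecting_edges (ι := Finset V × V) R
    (fun i => a i.1) (fun i => i.2) (fun i => if i.2 ∈ i.1 then x i.1 else 0)
    (fun i => by split_ifs <;> simp [hx0])
    (fun i hi => by
      obtain ⟨hi, h0⟩ := ite_ne_right_iff.1 hi
      have hK := (hx.2.1 _ h0).1
      exact ⟨hK (ha _ h0).1, hK hi⟩)
    (fun f => by
      refine (hx.partition_le f).trans ?_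
      rw [Fintype.sum_prod_type]
      refine Finset.sum_le_sum fun K _ => ?_
      by_cases h0 : x K = 0
      · simp [h0]
      have hsub : K.image f ⊆ insert (f (a K)) ((K.filter fun k => f (a K) ≠ f k).image f) := by
        intro y hy
        obtain ⟨k, hk, rfl⟩ := Finset.mem_image.1 hy
        by_cases h : f (a K) = f k
        · simp [h]
        · exact Finset.mem_insert_of_mem
            (Finset.mem_image_of_mem f (Finset.mem_filter.2 ⟨hk, h⟩))
      have hcard : (K.image f).card ≤ (K.filter fun k => f (a K) ≠ f k).card + 1 :=
        (Finset.card_le_card hsub).trans ((Finset.card_insert_le _ _).trans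
          (Nat.succ_le_succ Finset.card_image_le))
      have hcard' : ((K.image f).card : ℝ) ≤ (K.filter fun k => f (a K) ≠ f k).card + 1 := by
        exact_mod_cast hcard
      have hsum : (∑ k, if f (a K) ≠ f k then (if k ∈ K then x K else 0) else 0) =
          x K * (K.filter fun k => f (a K) ≠ f k).card := by
        rw [← Finset.sum_filter, ← Finset.sum_filter, Finset.sum_const, nsmul_eq_mul, mul_comm,
          Finset.filter_filter]
        congr 3
        ext k
        simp [and_comm]
      rw [hsum]
      exact mul_le_mul_of_nonneg_left (by linarith) (hx0 K))
    R.card id (by simp) c (fun u _ v _ _ => hc _)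
  have hconn : ∀ u ∈ R, ∀ v ∈ R,
      (SimpleGraph.fromEdgeSet (↑T : Set (Sym2 V))).Reachable u v := by
    refine hTr _ (SimpleGraph.reachable_is_equivalence _) (fun u v h => ?_) ?_
    · exact SimpleGraph.Adj.reachable
        ((SimpleGraph.fromEdgeSet_adj _).2 ⟨h, fun h' => (hTR _ h).1 (by simp [h'])⟩)
    · rintro u - v - rfl
      exact SimpleGraph.Reachable.refl _
  have hTE : T ⊆ E := by
    intro e he
    obtain ⟨hd, hR⟩ := hTR e he
    induction e with
    | _ u v => exact hRcomplete u (hR u (by simp)) v (hR v (by simp)) fun h => hd (by simp [h])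
  obtain ⟨T', hT', hspan⟩ := exists_isSpanningTreeOn_subset hTE (fun e he => (hTR e he).2) hconn
  calc mstR ≤ cost c T' := hmst.2 T' hspan
    _ ≤ ∑ e ∈ T, c e := Finset.sum_le_sum_of_subset_of_nonneg hT' fun e _ _ => hc e
    _ ≤ _ := hTw
    _ ≤ ∑ K : Finset V, 2 * (x K * (CK K - lossK K)) := by
      rw [Fintype.sum_prod_type]
      refine Finset.sum_le_sum fun K _ => ?_
      by_cases h0 : x K = 0
      · simp [h0]
      have hsum : (∑ k, if a K ≠ k then (if k ∈ K then x K else 0) * c s(a K, k) else 0) =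
          x K * ∑ k ∈ K.erase (a K), c s(a K, k) := by
        rw [Finset.mul_sum, ← Finset.sum_filter]
        simp only [ite_mul, zero_mul]
        rw [← Finset.sum_filter, Finset.filter_filter]
        refine Finset.sum_congr ?_ fun _ _ => rfl
        ext k
        simp [eq_comm]
      have := mul_le_mul_of_nonneg_left (ha K h0).2 (hx0 K)
      simp only [id]
      rw [hsum]
      linarith
    _ = _ := (Finset.mul_sum _ _ _).symm
end

section
/- Let 0 ≤ ℓ ≤ L be real numbers, M ≥ 1, and let q = (1 − 1/M)^t for a nonnegative integer t. Then (L − ℓ)·(1 + q) + (t/M)·ℓ ≤ L·(1 + exp(−t/M)) + ℓ·(t/M − 1 − exp(−t/M)); moreover, if t/M = α where α is the unique real solution of α = 1 + exp(−α), then the right-hand side equals α·L, so (L − ℓ)·(1 + (1 − 1/M)^t) + (t/M)·ℓ ≤ α·L. -/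
/-!
STATEMENT 11: the arithmetic bound for the quasi-bipartite analysis of the randomized
loss-contracting algorithm. `L` plays the role of `lp*`, `ℓ` of `loss*` (with the refined
initial bound `mst(G[R]) ≤ 2(L − ℓ)`), `t = αM` is the number of iterations and `M` the
normalization constant.
-/

/-- `(1 - 1/M)^t ≤ exp (-t/M)` for `M ≥ 1`. -/
theorem one_sub_one_div_pow_le_exp {M : ℝ} (hM : 1 ≤ M) (t : ℕ) :
    (1 - 1 / M) ^ t ≤ Real.exp (-(t : ℝ) / M) := by
  have h0 : 0 ≤ 1 - 1 / M := sub_nonneg.2 ((div_le_one (by linarith)).2 hM)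
  calc (1 - 1 / M) ^ t ≤ Real.exp (-(1 / M)) ^ t :=
        pow_le_pow_left₀ h0 (Real.one_sub_le_exp_neg _) t
    _ = Real.exp (-(t : ℝ) / M) := by
        rw [← Real.exp_nat_mul]
        congr 1
        ring

theorem quasi_bipartite_arithmetic (L ℓ M : ℝ) (hl0 : 0 ≤ ℓ) (hlL : ℓ ≤ L) (hM : 1 ≤ M)
    (t : ℕ) (α : ℝ) (hα : α = 1 + Real.exp (-α)) :
    ((L - ℓ) * (1 + (1 - 1 / M) ^ t) + ((t : ℝ) / M) * ℓ ≤
      L * (1 + Real.exp (-(t : ℝ) / M)) +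
        ℓ * ((t : ℝ) / M - 1 - Real.exp (-(t : ℝ) / M))) ∧
    ((t : ℝ) / M = α →
      L * (1 + Real.exp (-(t : ℝ) / M)) +
          ℓ * ((t : ℝ) / M - 1 - Real.exp (-(t : ℝ) / M)) = α * L ∧
      (L - ℓ) * (1 + (1 - 1 / M) ^ t) + ((t : ℝ) / M) * ℓ ≤ α * L) := by
  have hbound : (L - ℓ) * (1 + (1 - 1 / M) ^ t) + ((t : ℝ) / M) * ℓ ≤
      L * (1 + Real.exp (-(t : ℝ) / M)) +
        ℓ * ((t : ℝ) / M - 1 - Real.exp (-(t : ℝ) / M)) := by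
    linarith [mul_le_mul_of_nonneg_left (one_sub_one_div_pow_le_exp hM t) (sub_nonneg.2 hlL)]
  refine ⟨hbound, fun ht => ?_⟩
  have heq : L * (1 + Real.exp (-(t : ℝ) / M)) +
      ℓ * ((t : ℝ) / M - 1 - Real.exp (-(t : ℝ) / M)) = α * L := by
    rw [neg_div, ht]
    linear_combination (ℓ - L) * hα
  exact ⟨heq, hbound.trans_eq heq⟩
end

section
/- Let K_1, …, K_t be terminal sets with full components F(K_1), …, F(K_t), and let T be a spanning tree of the multigraph on vertex set R whose edge set is E(G[R]) together with the (parallel) edges of LC(K_1), …, LC(K_t). Then the subgraph of G whose edge set consists of the edges of T lying in G[R], together with ⋃_{i=1}^t Loss(K_i) and, for each edge of T lying in LC(K_i), the corresponding edge of F(K_i) ∖ Loss(K_i), connects all terminals of R; in particular T together with ⋃_{i=1}^t Loss(K_i) contains a Steiner tree. -/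
/-!
Setting: a finite graph on vertex type `V` is given by its edge set `E : Finset (Sym2 V)`,
with edge costs `c : Sym2 V → ℝ` (nonnegative, satisfying the triangle inequality).
The terminals form a set `R : Finset V`; all other vertices are Steiner vertices.
-/

open Finset

variable {V : Type} [Fintype V] [DecidableEq V]

/-!
STATEMENT 13: let `K 1, …, K t` be terminal sets with full components `Fc i`, loss sets
`L i = Loss(K i)` and contraction maps `π i` (sending each Steiner vertex of `Fc i` to the
terminal of `K i` its loss connects it to, and fixing terminals); the edges of `LC(K i)`
are the `π i`-images of the edges `Fc i \ L i`. Let `T` be a spanning tree of the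
multigraph on `R` whose edges are those of `G[R]` together with the parallel edges of the
`LC(K i)`; concretely `T` consists of `A ⊆ E(G[R])` together with, for each `i`, a set
`B i ⊆ Fc i \ L i` of (preimages of) `LC(K i)`-edges, connecting all terminals with
`|A| + ∑ᵢ |B i| = |R| − 1`. Then `A ∪ ⋃ᵢ (L i ∪ B i)` connects all terminals of `R`;
in particular it contains a Steiner tree.
-/

theorem SimpleGraph.Reachable.of_forall_adj {W : Type*} {G H : SimpleGraph W}
    (h : ∀ a b, G.Adj a b → H.Reachable a b) {u v : W} (huv : G.Reachable u v) :
    H.Reachable u v := by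
  obtain ⟨p⟩ := huv
  induction p with
  | nil => exact .refl _
  | cons hadj _ ih => exact (h _ _ hadj).trans ih

theorem degIn_ne_zero_iff {W : Type} [DecidableEq W] {F : Finset (Sym2 W)} {v : W} :
    degIn F v ≠ 0 ↔ ∃ e ∈ F, v ∈ e := by
  simp [degIn, Finset.filter_eq_empty_iff]

/-- A set of edges connecting all terminals, each of whose edges is connected to a terminal,
contains a Steiner tree. -/
theorem exists_isSteinerTree_subset_s13 {E U : Finset (Sym2 V)} {R : Finset V} (hUE : U ⊆ E)
    (hconn : ∀ u ∈ R, ∀ v ∈ R,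
      (SimpleGraph.fromEdgeSet (↑U : Set (Sym2 V))).Reachable u v)
    (htouch : ∀ e ∈ U, ∀ v ∈ e, ∃ r ∈ R,
      (SimpleGraph.fromEdgeSet (↑U : Set (Sym2 V))).Reachable v r) :
    ∃ S ⊆ U, IsSteinerTree E R S := by
  classical
  obtain ⟨F, hFU, hF, hreach⟩ :=
    (SimpleGraph.fromEdgeSet (↑U : Set (Sym2 V))).exists_isAcyclic_reachable_eq_le
  have hSU : F.edgeFinset ⊆ U := fun e he => by
    have := SimpleGraph.edgeSet_mono hFU (SimpleGraph.mem_edgeFinset.mp he)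
    rw [SimpleGraph.edgeSet_fromEdgeSet] at this
    exact this.1
  refine ⟨F.edgeFinset, hSU, hSU.trans hUE, ?_⟩
  simp only [SimpleGraph.coe_edgeFinset, SimpleGraph.fromEdgeSet_edgeSet, hreach,
    degIn_ne_zero_iff]
  exact ⟨hF, hconn, fun v ⟨e, he, hve⟩ => htouch e (hSU he) v hve⟩

theorem output_contains_steiner_tree
    (E : Finset (Sym2 V)) (R : Finset V) (c : Sym2 V → ℝ)
    (t : ℕ) (K : Fin t → Finset V) (Fc L : Fin t → Finset (Sym2 V))
    (hFc : ∀ i, IsFullComponent E R (K i) (Fc i))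
    (hL : ∀ i, IsMinLoss c R (Fc i) (L i))
    (π : Fin t → V → V)
    (hπR : ∀ i, ∀ v ∈ R, π i v = v)
    (hπS : ∀ i, ∀ v : V, v ∉ R → degIn (Fc i) v ≠ 0 →
      π i v ∈ K i ∧ (SimpleGraph.fromEdgeSet (↑(L i) : Set (Sym2 V))).Reachable v (π i v))
    (A : Finset (Sym2 V)) (B : Fin t → Finset (Sym2 V))
    (hA : A ⊆ E ∩ cliqueEdges R)
    (hB : ∀ i, B i ⊆ Fc i \ L i)
    (hconn : ∀ u ∈ R, ∀ v ∈ R,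
      (SimpleGraph.fromEdgeSet
        (↑(A ∪ Finset.univ.biUnion fun i => (B i).image (Sym2.map (π i))) :
          Set (Sym2 V))).Reachable u v)
    (hcard : A.card + ∑ i, (B i).card + 1 = R.card) :
    (∀ u ∈ R, ∀ v ∈ R,
      (SimpleGraph.fromEdgeSet
        (↑(A ∪ Finset.univ.biUnion fun i => L i ∪ B i) : Set (Sym2 V))).Reachable u v) ∧
    ∃ S ⊆ A ∪ Finset.univ.biUnion fun i => L i ∪ B i, IsSteinerTree E R S := by
  set U := A ∪ Finset.univ.biUnion fun i => L i ∪ B i with hU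
  set G := SimpleGraph.fromEdgeSet (↑U : Set (Sym2 V)) with hG
  have hAU : A ⊆ U := Finset.subset_union_left
  have hLBU : ∀ i, L i ∪ B i ⊆ U := fun i =>
    (Finset.subset_biUnion_of_mem (fun i => L i ∪ B i) (Finset.mem_univ i)).trans
      Finset.subset_union_right
  have hLU : ∀ i, L i ⊆ U := fun i => Finset.subset_union_left.trans (hLBU i)
  have hBU : ∀ i, B i ⊆ U := fun i => Finset.subset_union_right.trans (hLBU i)
  have hBF : ∀ i, B i ⊆ Fc i := fun i => (hB i).trans Finset.sdiff_subset
  have hπ : ∀ i, ∀ e ∈ Fc i, ∀ v ∈ e, π i v ∈ R ∧ G.Reachable v (π i v) := by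
    intro i e he v hv
    by_cases hvR : v ∈ R
    · rw [hπR i v hvR]
      exact ⟨hvR, .refl _⟩
    · obtain ⟨hK, hr⟩ := hπS i v hvR (degIn_ne_zero_iff.mpr ⟨e, he, hv⟩)
      exact ⟨(hFc i).2.1 hK,
        hr.mono (SimpleGraph.fromEdgeSet_mono (Finset.coe_subset.mpr (hLU i)))⟩
  have hGadj : ∀ a b, s(a, b) ∈ U → G.Reachable a b := by
    intro a b hab
    by_cases h : a = b
    · exact h ▸ .refl _
    · exact SimpleGraph.Adj.reachable ((SimpleGraph.fromEdgeSet_adj _).mpr ⟨hab, h⟩)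
  have hGconn : ∀ u ∈ R, ∀ v ∈ R, G.Reachable u v := by
    intro u hu v hv
    refine (hconn u hu v hv).of_forall_adj fun a b hab => ?_
    have hmem := ((SimpleGraph.fromEdgeSet_adj _).mp hab).1
    rw [Finset.mem_coe, Finset.mem_union] at hmem
    rcases hmem with hmem | hmem
    · exact hGadj a b (hAU hmem)
    · simp only [Finset.mem_biUnion, Finset.mem_univ, true_and, Finset.mem_image] at hmem
      obtain ⟨i, e, he, heq⟩ := hmem
      induction e using Sym2.ind with
      | _ x y =>
        have hx := (hπ i _ (hBF i he) x (Sym2.mem_mk_left x y)).2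
        have hy := (hπ i _ (hBF i he) y (Sym2.mem_mk_right x y)).2
        have hxy := (hx.symm.trans (hGadj x y (hBU i he))).trans hy
        rw [Sym2.map_mk, Sym2.eq_iff] at heq
        rcases heq with ⟨rfl, rfl⟩ | ⟨rfl, rfl⟩
        · exact hxy
        · exact hxy.symm
  have hU_cases : ∀ e ∈ U, e ∈ A ∨ ∃ i, e ∈ Fc i := by
    intro e he
    simp only [hU, Finset.mem_union, Finset.mem_biUnion, Finset.mem_univ, true_and] at he
    exact he.imp_right fun ⟨i, hi⟩ => ⟨i, hi.elim (fun h => (hL i).1.1 h) (fun h => hBF i h)⟩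
  refine ⟨hGconn, exists_isSteinerTree_subset_s13 (fun e he => ?_) hGconn fun e he v hv => ?_⟩
  · rcases hU_cases e he with h | ⟨i, h⟩
    · exact (Finset.mem_inter.mp (hA h)).1
    · exact (hFc i).1 h
  · rcases hU_cases e he with h | ⟨i, h⟩
    · have hclique := (Finset.mem_inter.mp (hA h)).2
      simp only [cliqueEdges, Finset.mem_image, Finset.mem_product] at hclique
      obtain ⟨p, ⟨hp₁, hp₂⟩, rfl⟩ := hclique
      refine ⟨v, ?_, .refl _⟩
      rcases Sym2.mem_iff.mp hv with rfl | rfl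
      · exact hp₁
      · exact hp₂
    · exact ⟨π i v, hπ i e h v hv⟩
end
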